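/- arXiv:2405.16663 — 3 statements merged into one kernel-verified Lean document; each statement's English description precedes it below -/
import Mathlib

section
/- There exist absolute constants C₀, C₁, c' > 0 such that the following holds for all sufficiently large n. Let d° satisfy C₁ ≤ d° ≤ n and let η ∈ [0,1]. Then with probability at least 1 − n^{−c'} over a random graph A° drawn from the Erdős–Rényi distribution G(n, d°/n), all of the following hold: (i) |d(A°) − d°| ≤ 10·√(d°·log n/n); (ii) |(A°·𝟙)_i − d(A°)| ≤ 2·(log n)·√d° for all i; (iii) ‖A° − (d(A°)/n)·𝟙𝟙ᵀ‖ ≤ 2·C₀·√(d°·log n), where ‖·‖ is the spectral norm; and consequently (iv) for every n-node graph A with dist(A, A°) ≤ η·n and every d̂ ≥ d°/2, there exists z* ∈ {0,1}^n such that (A°, z*) satisfies the feasibility constraints P1(A, η), |(A°·𝟙)_i − d(A°)| ≤ 4·(log n)·√d̂ for all i, and ‖A° − (d(A°)/n)·𝟙𝟙ᵀ‖ ≤ 4·C₀·√(log n)·√d̂. -/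
open scoped BigOperators Classical

namespace EdgeDensity

/-- A graph on `n` nodes, identified with its Boolean adjacency function:
symmetric with no self-loops. -/
def IsGraph {n : ℕ} (A : Fin n → Fin n → Bool) : Prop :=
  (∀ i j, A i j = A j i) ∧ ∀ i, A i i = false

/-- The real adjacency matrix of a Boolean graph. -/
def adjMat {n : ℕ} (A : Fin n → Fin n → Bool) : Matrix (Fin n) (Fin n) ℝ :=
  Matrix.of fun i j => if A i j then 1 else 0

/-- `d(M) = (1/n) ∑_{i,j} M i j`, the average row sum. -/
noncomputable def dbar {n : ℕ} (M : Matrix (Fin n) (Fin n) ℝ) : ℝ :=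
  (∑ i, ∑ j, M i j) / n

/-- `(M 𝟙)_i = ∑_j M i j`, the `i`-th row sum (degree of node `i`). -/
def rowSum {n : ℕ} (M : Matrix (Fin n) (Fin n) ℝ) (i : Fin n) : ℝ := ∑ j, M i j

/-- The probability that the inhomogeneous random graph `G(n,Q)` equals the
given graph `A`: each edge `{i,j}` with `i < j` is present independently with
probability `Q i j`. -/
noncomputable def erWeight {n : ℕ} (Q : Matrix (Fin n) (Fin n) ℝ)
    (A : Fin n → Fin n → Bool) : ℝ :=
  ∏ i, ∏ j ∈ Finset.univ.filter (fun j => i < j),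
    (if A i j then Q i j else 1 - Q i j)

/-- Probability of the event `E` under the inhomogeneous random graph `G(n,Q)`. -/
noncomputable def erProb {n : ℕ} (Q : Matrix (Fin n) (Fin n) ℝ)
    (E : (Fin n → Fin n → Bool) → Prop) : ℝ :=
  ∑ A ∈ Finset.univ.filter (fun A => IsGraph A ∧ E A), erWeight Q A

/-- Node distance between two graphs: the minimum cardinality of a set `S` of
nodes such that the two adjacency matrices agree on all entries `(i,j)` with
`i ∉ S` and `j ∉ S`. -/
noncomputable def nodeDist {n : ℕ} (A B : Fin n → Fin n → Bool) : ℕ :=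
  sInf {k | ∃ S : Finset (Fin n), S.card = k ∧
    ∀ i j, i ∉ S → j ∉ S → A i j = B i j}

/-- The feasibility constraints `P1(A, γ)` on a pair `(Y, z)`. -/
def P1 {n : ℕ} (A : Matrix (Fin n) (Fin n) ℝ) (γ : ℝ)
    (Y : Matrix (Fin n) (Fin n) ℝ) (z : Fin n → ℝ) : Prop :=
  (∀ i, z i = 0 ∨ z i = 1) ∧
  ((1 - γ) * n ≤ ∑ i, z i) ∧
  (∀ i j, Y i j = Y j i) ∧
  (∀ i j, 0 ≤ Y i j ∧ Y i j ≤ 1) ∧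
  (∀ i j, Y i j * z i * z j = A i j * z i * z j)

/-- The binomial probability mass function `Bin(n,p)` at `k`. -/
noncomputable def binomPMF (n : ℕ) (p : ℝ) (k : ℕ) : ℝ :=
  (n.choose k : ℝ) * p ^ k * (1 - p) ^ (n - k)

/-- Total variation distance between `Bin(n,p)` and `Bin(n,q)`. -/
noncomputable def binomTV (n : ℕ) (p q : ℝ) : ℝ :=
  (∑ k ∈ Finset.range (n + 1), |binomPMF n p k - binomPMF n q k|) / 2

/-- The spectral norm (largest singular value) of a real square matrix. -/
noncomputable def specNorm {n : ℕ} (M : Matrix (Fin n) (Fin n) ℝ) : ℝ :=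
  ‖LinearMap.toContinuousLinearMap (Matrix.toEuclideanLin M)‖

/-- A randomized algorithm on `n`-node graphs is `ε`-differentially
node-private. -/
def IsNodeDP {n : ℕ} (ε : ℝ)
    (𝒜 : (Fin n → Fin n → Bool) → MeasureTheory.Measure ℝ) : Prop :=
  ∀ G G', IsGraph G → IsGraph G' → nodeDist G G' ≤ 1 →
    ∀ S : Set ℝ, MeasurableSet S →
      𝒜 G S ≤ ENNReal.ofReal (Real.exp ε) * 𝒜 G' S

/-- `Pr_{G ~ G(n,Q), 𝒜}[𝒜(G) ∈ S]`. -/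
noncomputable def algProb {n : ℕ} (Q : Matrix (Fin n) (Fin n) ℝ)
    (𝒜 : (Fin n → Fin n → Bool) → MeasureTheory.Measure ℝ) (S : Set ℝ) : ℝ :=
  ∑ A ∈ Finset.univ.filter (fun A => IsGraph A), erWeight Q A * (𝒜 A S).toReal


section BernoulliProduct

variable {ι : Type*} [Fintype ι]

/-- The indicator value of a Boolean. -/
def boolVal (b : Bool) : ℝ := if b then 1 else 0

lemma boolVal_nonneg (b : Bool) : 0 ≤ boolVal b := by cases b <;> simp [boolVal]

lemma boolVal_le_one (b : Bool) : boolVal b ≤ 1 := by cases b <;> simp [boolVal]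

/-- The weight of `ω` under the product of Bernoulli distributions of parameter `q`. -/
noncomputable def bernWeight (q : ℝ) (ω : ι → Bool) : ℝ := ∏ e, if ω e then q else 1 - q

lemma bernWeight_nonneg {q : ℝ} (h0 : 0 ≤ q) (h1 : q ≤ 1) (ω : ι → Bool) :
    0 ≤ bernWeight q ω :=
  Finset.prod_nonneg fun e _ => by split_ifs <;> linarith

variable [DecidableEq ι]

/-- Expectation under the product of Bernoulli distributions of parameter `q`. -/
noncomputable def bernExp (q : ℝ) (f : (ι → Bool) → ℝ) : ℝ := ∑ ω, bernWeight q ω * f ω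

lemma bernExp_mono {q : ℝ} (h0 : 0 ≤ q) (h1 : q ≤ 1) {f g : (ι → Bool) → ℝ}
    (h : ∀ ω, f ω ≤ g ω) : bernExp q f ≤ bernExp q g :=
  Finset.sum_le_sum fun ω _ => mul_le_mul_of_nonneg_left (h ω) (bernWeight_nonneg h0 h1 ω)

lemma bernExp_add (q : ℝ) (f g : (ι → Bool) → ℝ) :
    bernExp q (fun ω => f ω + g ω) = bernExp q f + bernExp q g := by
  simp only [bernExp, mul_add, Finset.sum_add_distrib]

lemma bernExp_const_mul (q c : ℝ) (f : (ι → Bool) → ℝ) :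
    bernExp q (fun ω => c * f ω) = c * bernExp q f := by
  simp only [bernExp, Finset.mul_sum]
  exact Finset.sum_congr rfl fun _ _ => by ring

lemma bernExp_sum {κ : Type*} (s : Finset κ) (q : ℝ) (f : κ → (ι → Bool) → ℝ) :
    bernExp q (fun ω => ∑ k ∈ s, f k ω) = ∑ k ∈ s, bernExp q (f k) := by
  simp only [bernExp, Finset.mul_sum]
  exact Finset.sum_comm

lemma bernExp_prod (q : ℝ) (g : ι → Bool → ℝ) :
    bernExp q (fun ω => ∏ e, g e (ω e)) = ∏ e, (q * g e true + (1 - q) * g e false) := by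
  have h := Finset.prod_univ_sum (fun _ : ι => (Finset.univ : Finset Bool))
    (fun e b => (if b then q else 1 - q) * g e b)
  simp only [Fintype.sum_bool, Fintype.piFinset_univ] at h
  simp only [bernExp, bernWeight, ← Finset.prod_mul_distrib]
  rw [← h]
  simp

lemma bernExp_const (q c : ℝ) : bernExp q (fun _ : ι → Bool => c) = c := by
  have h := bernExp_prod q (fun (_ : ι) _ => (1 : ℝ))
  have h2 := bernExp_const_mul q c (fun _ : ι → Bool => (1 : ℝ))
  simp only [mul_one, add_sub_cancel, Finset.prod_const_one] at h h2
  rw [h2, h, mul_one]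

lemma bernExp_coord (q : ℝ) (e : ι) (g : Bool → ℝ) :
    bernExp q (fun ω => g (ω e)) = q * g true + (1 - q) * g false := by
  have h := bernExp_prod q (fun e' b => if e' = e then g b else 1)
  rw [Finset.prod_eq_single e (by intro b _ hb; simp [hb]) (by simp)] at h
  simpa using h

/-- Independent resampling of the coordinates outside `S`. -/
lemma bernExp_piecewise (q : ℝ) (S : Finset ι) (f : (ι → Bool) → ℝ) :
    bernExp q f = bernExp q (fun ω => bernExp q (fun ω' => f (S.piecewise ω ω'))) := by
  have hw : ∀ ω ω' : ι → Bool, bernWeight q (S.piecewise ω ω') * bernWeight q (S.piecewise ω' ω)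
      = bernWeight q ω * bernWeight q ω' := by
    intro ω ω'
    simp only [bernWeight, ← Finset.prod_mul_distrib]
    refine Finset.prod_congr rfl fun e _ => ?_
    by_cases he : e ∈ S <;> simp [he, mul_comm]
  have h1 : bernExp q f = ∑ x : (ι → Bool) × (ι → Bool),
      bernWeight q x.1 * bernWeight q x.2 * f x.1 := by
    have := bernExp_const (ι := ι) q 1
    simp only [bernExp, mul_one] at this
    rw [Fintype.sum_prod_type]
    refine Finset.sum_congr rfl fun ω _ => ?_
    simp only
    rw [← Finset.sum_mul, ← Finset.mul_sum, this, mul_one]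
  have h2 : bernExp q (fun ω => bernExp q (fun ω' => f (S.piecewise ω ω')))
      = ∑ x : (ι → Bool) × (ι → Bool),
        bernWeight q x.1 * bernWeight q x.2 * f (S.piecewise x.1 x.2) := by
    rw [Fintype.sum_prod_type]
    simp only [bernExp, Finset.mul_sum, mul_assoc]
  have hinv : ∀ x : (ι → Bool) × (ι → Bool),
      (S.piecewise (S.piecewise x.1 x.2) (S.piecewise x.2 x.1),
        S.piecewise (S.piecewise x.2 x.1) (S.piecewise x.1 x.2)) = x := by
    rintro ⟨a, b⟩
    refine Prod.ext ?_ ?_ <;> funext e <;> by_cases he : e ∈ S <;> simp [he]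
  rw [h1, h2]
  refine (Finset.sum_nbij' (fun x => (S.piecewise x.1 x.2, S.piecewise x.2 x.1))
    (fun x => (S.piecewise x.1 x.2, S.piecewise x.2 x.1)) (by simp) (by simp)
    (fun x _ => hinv x) (fun x _ => hinv x) ?_).symm
  intro x _
  simp only [hw]

/-- Averaging over a single coordinate. -/
lemma bernExp_update (q : ℝ) (e : ι) (f : (ι → Bool) → ℝ) :
    bernExp q f = bernExp q (fun ω =>
      q * f (Function.update ω e true) + (1 - q) * f (Function.update ω e false)) := by
  rw [bernExp_piecewise q (Finset.univ.erase e) f]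
  congr 1
  funext ω
  rw [← bernExp_coord q e (fun b => f (Function.update ω e b))]
  congr 1
  funext ω'
  congr 1
  funext e'
  by_cases h : e' = e
  · subst h; simp
  · simp [h]

lemma bernExp_exp_le {q : ℝ} (h0 : 0 ≤ q) (h1 : q ≤ 1) (c : ι → ℝ) :
    bernExp q (fun ω => Real.exp (∑ e, c e * boolVal (ω e)))
      ≤ Real.exp (q * ∑ e, (Real.exp (c e) - 1)) := by
  simp only [Real.exp_sum]
  rw [bernExp_prod q (fun e b => Real.exp (c e * boolVal b)), Finset.mul_sum, Real.exp_sum]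
  refine Finset.prod_le_prod (fun e _ => ?_) (fun e _ => ?_)
  · have := Real.exp_pos (c e * boolVal true)
    have := Real.exp_pos (c e * boolVal false)
    have : 0 ≤ 1 - q := by linarith
    positivity
  · have := Real.add_one_le_exp (q * (Real.exp (c e) - 1))
    simp only [boolVal, if_true, Bool.false_eq_true, if_false, mul_one, mul_zero, Real.exp_zero]
    linarith

/-- The probability of an event under the product of Bernoulli distributions. -/
noncomputable def bernProb (q : ℝ) (E : (ι → Bool) → Prop) : ℝ :=
  bernExp q (fun ω => if E ω then 1 else 0)

lemma bernProb_le {q : ℝ} (h0 : 0 ≤ q) (h1 : q ≤ 1) {E : (ι → Bool) → Prop}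
    {f : (ι → Bool) → ℝ} (hf : ∀ ω, 0 ≤ f ω) (h : ∀ ω, E ω → 1 ≤ f ω) :
    bernProb q E ≤ bernExp q f := by
  refine bernExp_mono h0 h1 fun ω => ?_
  split_ifs with hE
  · exact h ω hE
  · exact hf ω

lemma bernProb_mono {q : ℝ} (h0 : 0 ≤ q) (h1 : q ≤ 1) {E F : (ι → Bool) → Prop}
    (h : ∀ ω, E ω → F ω) : bernProb q E ≤ bernProb q F :=
  bernProb_le h0 h1 (fun ω => by split_ifs <;> norm_num) fun ω hE => by simp [h ω hE]

lemma bernProb_or_le {q : ℝ} (h0 : 0 ≤ q) (h1 : q ≤ 1) (E F : (ι → Bool) → Prop) :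
    bernProb q (fun ω => E ω ∨ F ω) ≤ bernProb q E + bernProb q F := by
  unfold bernProb
  rw [← bernExp_add]
  refine bernExp_mono h0 h1 fun ω => ?_
  by_cases hE : E ω <;> by_cases hF : F ω <;> simp [hE, hF]

lemma bernProb_exists_le {κ : Type*} [Fintype κ] {q : ℝ} (h0 : 0 ≤ q) (h1 : q ≤ 1)
    (E : κ → (ι → Bool) → Prop) :
    bernProb q (fun ω => ∃ k, E k ω) ≤ ∑ k, bernProb q (E k) := by
  unfold bernProb
  rw [← bernExp_sum]
  refine bernExp_mono h0 h1 fun ω => ?_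
  have hnn : ∀ k ∈ Finset.univ, (0 : ℝ) ≤ if E k ω then 1 else 0 := fun k _ => by
    split_ifs <;> norm_num
  split_ifs with h
  · obtain ⟨k, hk⟩ := h
    calc (1 : ℝ) = if E k ω then 1 else 0 := by simp [hk]
      _ ≤ _ := Finset.single_le_sum hnn (Finset.mem_univ k)
  · exact Finset.sum_nonneg hnn

lemma bernProb_not (q : ℝ) (E : (ι → Bool) → Prop) :
    bernProb q E = 1 - bernProb q (fun ω => ¬ E ω) := by
  rw [eq_sub_iff_add_eq]
  unfold bernProb
  rw [← bernExp_add]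
  refine Eq.trans ?_ (bernExp_const (ι := ι) q 1)
  congr 1
  funext ω
  by_cases hE : E ω <;> simp [hE]

/-- Two-sided Chernoff bound for a weighted sum of Bernoulli variables. -/
lemma bernProb_abs_gt_le {q : ℝ} (h0 : 0 ≤ q) (h1 : q ≤ 1) (c : ι → ℝ)
    (hc0 : ∀ e, 0 ≤ c e) (hc1 : ∀ e, c e ≤ 1) {m θ : ℝ} (t : ℝ) (hm : q * ∑ e, c e ≤ m)
    (hθ0 : 0 ≤ θ) (hθ1 : θ ≤ 1) :
    bernProb q (fun ω => t < |∑ e, c e * boolVal (ω e) - q * ∑ e, c e|)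
      ≤ 2 * Real.exp (m * θ ^ 2 - θ * t) := by
  have one : ∀ s : ℝ, |s| = θ →
      bernExp q (fun ω => Real.exp (s * (∑ e, c e * boolVal (ω e) - q * ∑ e, c e) - θ * t))
        ≤ Real.exp (m * θ ^ 2 - θ * t) := by
    intro s hs
    have hs2 : s ^ 2 = θ ^ 2 := by rw [← hs, sq_abs]
    have e1 : ∀ ω : ι → Bool,
        Real.exp (s * (∑ e, c e * boolVal (ω e) - q * ∑ e, c e) - θ * t)
        = Real.exp (-(s * (q * ∑ e, c e)) - θ * t)
          * Real.exp (∑ e, (s * c e) * boolVal (ω e)) := by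
      intro ω
      rw [← Real.exp_add]
      congr 1
      simp only [mul_assoc, ← Finset.mul_sum]
      ring
    simp only [e1]
    rw [bernExp_const_mul]
    refine (mul_le_mul_of_nonneg_left (bernExp_exp_le h0 h1 _) (Real.exp_pos _).le).trans ?_
    rw [← Real.exp_add, Real.exp_le_exp]
    have h2 : ∑ e, (Real.exp (s * c e) - 1) ≤ ∑ e, (s * c e + θ ^ 2 * c e) := by
      refine Finset.sum_le_sum fun e _ => ?_
      have h3 : |s * c e| ≤ 1 := by
        rw [abs_mul, hs, abs_of_nonneg (hc0 e)]
        exact mul_le_one₀ hθ1 (hc0 e) (hc1 e)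
      have h4 := (abs_le.1 (Real.abs_exp_sub_one_sub_id_le h3)).2
      have h5 : (s * c e) ^ 2 ≤ θ ^ 2 * c e := by
        rw [mul_pow, hs2]
        exact mul_le_mul_of_nonneg_left (by nlinarith [hc0 e, hc1 e]) (sq_nonneg θ)
      linarith
    rw [Finset.sum_add_distrib, ← Finset.mul_sum, ← Finset.mul_sum] at h2
    have h6 := mul_le_mul_of_nonneg_left h2 h0
    have h7 := mul_le_mul_of_nonneg_right hm (sq_nonneg θ)
    nlinarith
  have h2 := add_le_add (one θ (abs_of_nonneg hθ0)) (one (-θ) (by rw [abs_neg, abs_of_nonneg hθ0]))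
  rw [← bernExp_add] at h2
  rw [two_mul]
  refine (bernProb_le h0 h1 (fun ω => by positivity) fun ω hω => ?_).trans h2
  rcases lt_abs.1 hω with h | h
  · have : 0 ≤ θ * (∑ e, c e * boolVal (ω e) - q * ∑ e, c e) - θ * t := by
      rw [← mul_sub]; exact mul_nonneg hθ0 (by linarith)
    exact le_add_of_le_of_nonneg (Real.one_le_exp this) (Real.exp_pos _).le
  · have : 0 ≤ -θ * (∑ e, c e * boolVal (ω e) - q * ∑ e, c e) - θ * t := by
      rw [neg_mul, ← mul_neg, ← mul_sub]; exact mul_nonneg hθ0 (by linarith)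
    exact le_add_of_nonneg_of_le (Real.exp_pos _).le (Real.one_le_exp this)

end BernoulliProduct

section MatrixMoments

variable {m ι : Type*} [Fintype ι]

/-- The centred random matrix `∑ₑ (ωₑ - q) Hₑ`. -/
noncomputable def centredSum (q : ℝ) (H : ι → Matrix m m ℝ) (ω : ι → Bool) : Matrix m m ℝ :=
  ∑ e, (boolVal (ω e) - q) • H e

lemma centredSum_transpose (q : ℝ) {H : ι → Matrix m m ℝ} (hH : ∀ e, (H e).transpose = H e)
    (ω : ι → Bool) : (centredSum q H ω).transpose = centredSum q H ω := by
  simp only [centredSum, Matrix.transpose_sum, Matrix.transpose_smul, hH]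

variable [DecidableEq ι]

lemma centredSum_update_sub (q : ℝ) (H : ι → Matrix m m ℝ) (ω : ι → Bool) (e : ι) :
    centredSum q H (Function.update ω e true) - centredSum q H (Function.update ω e false)
      = H e := by
  simp only [centredSum]
  rw [← Finset.sum_sub_distrib, Finset.sum_eq_single e]
  · rw [← sub_smul]
    simp [boolVal]
  · intro b _ hb
    simp [hb]
  · simp

variable [Fintype m] [DecidableEq m]

/-- Orthogonal diagonalization of a real symmetric matrix, together with its powers. -/
lemma exists_orthogonal_diag {M : Matrix m m ℝ} (hM : M.transpose = M) :
    ∃ (U : Matrix m m ℝ) (l : m → ℝ), U * U.transpose = 1 ∧ U.transpose * U = 1 ∧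
      ∀ k : ℕ, M ^ k = U * Matrix.diagonal (fun i => l i ^ k) * U.transpose := by
  have hH : M.IsHermitian := by
    rw [Matrix.IsHermitian, Matrix.conjTranspose_eq_transpose_of_trivial, hM]
  have hs : star (hH.eigenvectorUnitary : Matrix m m ℝ)
      = (hH.eigenvectorUnitary : Matrix m m ℝ).transpose := by
    rw [Matrix.star_eq_conjTranspose, Matrix.conjTranspose_eq_transpose_of_trivial]
  have hu2 : (hH.eigenvectorUnitary : Matrix m m ℝ).transpose * hH.eigenvectorUnitary = 1 := by
    rw [← hs]; exact Unitary.coe_star_mul_self _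
  refine ⟨hH.eigenvectorUnitary, hH.eigenvalues, ?_, hu2, ?_⟩
  · rw [← hs]; exact Unitary.coe_mul_star_self _
  · have h1 : M = (hH.eigenvectorUnitary : Matrix m m ℝ) * Matrix.diagonal hH.eigenvalues
        * (hH.eigenvectorUnitary : Matrix m m ℝ).transpose := by
      rw [← hs]
      conv_lhs => rw [hH.spectral_theorem, Unitary.conjStarAlgAut_apply]
      rfl
    generalize (hH.eigenvectorUnitary : Matrix m m ℝ) = U at *
    generalize hH.eigenvalues = l at *
    intro k
    induction k with
    | zero =>
      simp only [pow_zero, Matrix.diagonal_one, mul_one]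
      exact (mul_eq_one_comm.1 hu2).symm
    | succ k ih =>
      rw [pow_succ, ih]
      conv_lhs => rw [h1]
      calc _ = U * Matrix.diagonal (fun i => l i ^ k) * (U.transpose * U)
            * Matrix.diagonal l * U.transpose := by simp only [mul_assoc]
        _ = _ := by
          rw [hu2, mul_one, mul_assoc U, Matrix.diagonal_mul_diagonal]
          simp only [pow_succ]

lemma trace_pow_eq {M U : Matrix m m ℝ} {l : m → ℝ} (hU : U.transpose * U = 1)
    (h : ∀ k : ℕ, M ^ k = U * Matrix.diagonal (fun i => l i ^ k) * U.transpose) (k : ℕ) :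
    (M ^ k).trace = ∑ i, l i ^ k := by
  rw [h, Matrix.trace_mul_comm, ← mul_assoc, hU, one_mul, Matrix.trace_diagonal]

lemma pow_apply_self_eq {M U : Matrix m m ℝ} {l : m → ℝ}
    (h : ∀ k : ℕ, M ^ k = U * Matrix.diagonal (fun i => l i ^ k) * U.transpose) (k : ℕ) (i : m) :
    (M ^ k) i i = ∑ j, l j ^ k * U i j ^ 2 := by
  rw [h, Matrix.mul_apply]
  simp only [Matrix.mul_diagonal, Matrix.transpose_apply]
  exact Finset.sum_congr rfl fun j _ => by ring

lemma pow_two_mul_apply_self_nonneg {M : Matrix m m ℝ} (hM : M.transpose = M) (k : ℕ) (i : m) :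
    0 ≤ (M ^ (2 * k)) i i := by
  obtain ⟨U, l, -, -, h⟩ := exists_orthogonal_diag hM
  rw [pow_apply_self_eq h]
  refine Finset.sum_nonneg fun j _ => ?_
  rw [pow_mul]
  positivity

lemma abs_pow_mul_pow_le (x y : ℝ) (s r : ℕ) :
    x ^ s * y ^ r ≤ |x| ^ (s + r) + |y| ^ (s + r) := by
  have h1 : x ^ s * y ^ r ≤ |x| ^ s * |y| ^ r := by
    rw [← abs_pow, ← abs_pow, ← abs_mul]; exact le_abs_self _
  have hx := abs_nonneg x
  have hy := abs_nonneg y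
  rcases le_total |x| |y| with h | h
  · have : |x| ^ s * |y| ^ r ≤ |y| ^ s * |y| ^ r := by gcongr
    rw [← pow_add] at this
    have : 0 ≤ |x| ^ (s + r) := by positivity
    linarith
  · have : |x| ^ s * |y| ^ r ≤ |x| ^ s * |x| ^ r := by gcongr
    rw [← pow_add] at this
    have : 0 ≤ |y| ^ (s + r) := by positivity
    linarith

/-- A mean value inequality for traces of words in symmetric matrices. -/
lemma trace_mul_pow_mul_pow_le {M N H : Matrix m m ℝ} (hM : M.transpose = M)
    (hN : N.transpose = N) (hH : H.transpose = H) {s r k : ℕ} (hk : s + r = 2 * k) :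
    (H * (M ^ s * H * N ^ r)).trace
      ≤ (H * H * M ^ (2 * k)).trace + (H * H * N ^ (2 * k)).trace := by
  obtain ⟨U, l, hU1, hU2, h⟩ := exists_orthogonal_diag hM
  obtain ⟨V, μ, hV1, hV2, h'⟩ := exists_orthogonal_diag hN
  set R : Matrix m m ℝ := U.transpose * H * V with hR
  have hRt : R.transpose = V.transpose * H * U := by
    rw [hR, Matrix.transpose_mul, Matrix.transpose_mul, hH, Matrix.transpose_transpose, mul_assoc]
  have key : ∀ a b : m → ℝ,
      (Matrix.diagonal a * R * Matrix.diagonal b * R.transpose).trace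
        = ∑ i, ∑ j, a i * b j * R i j ^ 2 := by
    intro a b
    rw [Matrix.trace]
    refine Finset.sum_congr rfl fun i _ => ?_
    rw [Matrix.diag_apply, Matrix.mul_apply]
    refine Finset.sum_congr rfl fun j _ => ?_
    rw [Matrix.mul_diagonal, Matrix.diagonal_mul, Matrix.transpose_apply]
    ring
  have e1 : (H * (M ^ s * H * N ^ r)).trace = ∑ i, ∑ j, l i ^ s * μ j ^ r * R i j ^ 2 := by
    rw [← key, h, h', hRt, hR]
    rw [Matrix.trace_mul_comm (Matrix.diagonal (fun i => l i ^ s) * (U.transpose * H * V)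
      * Matrix.diagonal (fun j => μ j ^ r)) (V.transpose * H * U)]
    rw [Matrix.trace_mul_comm H]
    rw [show U * Matrix.diagonal (fun i => l i ^ s) * U.transpose * H
        * (V * Matrix.diagonal (fun i => μ i ^ r) * V.transpose) * H
        = (U * Matrix.diagonal (fun i => l i ^ s) * U.transpose * H
          * V * Matrix.diagonal (fun i => μ i ^ r)) * (V.transpose * H) by
        simp only [mul_assoc], Matrix.trace_mul_comm]
    simp only [mul_assoc]
  have e2 : (H * H * M ^ (2 * k)).trace = ∑ i, ∑ j, |l i| ^ (s + r) * 1 * R i j ^ 2 := by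
    rw [← key, h, hRt, hR]
    have : (Matrix.diagonal fun _ : m => (1 : ℝ)) = 1 := Matrix.diagonal_one
    rw [this, mul_one]
    have h3 : Matrix.diagonal (fun i => |l i| ^ (s + r)) * (U.transpose * H * V)
        * (V.transpose * H * U) = Matrix.diagonal (fun i => l i ^ (2 * k)) * U.transpose * H
        * (V * V.transpose) * H * U := by
      rw [hk]
      simp only [pow_mul, sq_abs, mul_assoc]
    rw [h3, hV1, mul_one, Matrix.trace_mul_comm _ U, Matrix.trace_mul_comm (H * H)]
    simp only [mul_assoc]
  have e3 : (H * H * N ^ (2 * k)).trace = ∑ i, ∑ j, 1 * |μ j| ^ (s + r) * R i j ^ 2 := by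
    rw [← key, h', hRt, hR]
    have : (Matrix.diagonal fun _ : m => (1 : ℝ)) = 1 := Matrix.diagonal_one
    rw [this, one_mul]
    have h3 : U.transpose * H * V * Matrix.diagonal (fun i => |μ i| ^ (s + r))
        * (V.transpose * H * U) = U.transpose * (H * V
          * Matrix.diagonal (fun i => μ i ^ (2 * k)) * V.transpose * H * U) := by
      rw [hk]
      simp only [pow_mul, sq_abs, mul_assoc]
    rw [h3, Matrix.trace_mul_comm U.transpose, mul_assoc _ U, hU1, mul_one, mul_assoc H H,
      Matrix.trace_mul_comm H]
    simp only [mul_assoc]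
  rw [e1, e2, e3, ← Finset.sum_add_distrib]
  refine Finset.sum_le_sum fun i _ => ?_
  rw [← Finset.sum_add_distrib]
  refine Finset.sum_le_sum fun j _ => ?_
  rw [← add_mul, mul_one, one_mul]
  exact mul_le_mul_of_nonneg_right (abs_pow_mul_pow_le _ _ _ _) (sq_nonneg _)

lemma pow_sub_pow_eq_sum {R : Type*} [Ring R] (x y : R) (k : ℕ) :
    x ^ k - y ^ k = ∑ s ∈ Finset.range k, x ^ s * (x - y) * y ^ (k - 1 - s) := by
  induction k with
  | zero => simp
  | succ k ih =>
    have h : ∑ s ∈ Finset.range k, x ^ s * (x - y) * y ^ (k - s)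
        = (∑ s ∈ Finset.range k, x ^ s * (x - y) * y ^ (k - 1 - s)) * y := by
      rw [Finset.sum_mul]
      refine Finset.sum_congr rfl fun s hs => ?_
      rw [mul_assoc _ _ y, ← pow_succ]
      congr 2
      have := Finset.mem_range.1 hs
      omega
    rw [Finset.sum_range_succ, Nat.add_sub_cancel, h, ← ih, Nat.sub_self, pow_zero, mul_one,
      pow_succ, pow_succ]
    noncomm_ring

lemma trace_mul_pow_sub_pow_le {M N H : Matrix m m ℝ} (hM : M.transpose = M)
    (hN : N.transpose = N) (hH : H.transpose = H) (hd : M - N = H) (k : ℕ) :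
    (H * M ^ (2 * k + 1)).trace - (H * N ^ (2 * k + 1)).trace
      ≤ (2 * k + 1) * ((H * H * M ^ (2 * k)).trace + (H * H * N ^ (2 * k)).trace) := by
  rw [← Matrix.trace_sub, ← mul_sub, pow_sub_pow_eq_sum, Finset.mul_sum, Matrix.trace_sum, hd]
  refine (Finset.sum_le_card_nsmul _ _
    ((H * H * M ^ (2 * k)).trace + (H * H * N ^ (2 * k)).trace) fun s hs => ?_).trans ?_
  · refine trace_mul_pow_mul_pow_le hM hN hH ?_
    have := Finset.mem_range.1 hs
    omega
  · rw [Finset.card_range, nsmul_eq_mul]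
    push_cast
    rfl

lemma sum_mul_pow_apply_self_le {M : Matrix m m ℝ} (hM : M.transpose = M) {a : m → ℝ}
    (ha : ∀ i, 0 ≤ a i) (k : ℕ) :
    ∑ i, a i * (M ^ (2 * k)) i i
      ≤ 1 / 2 * (M ^ (2 * (k + 1))).trace + 1 / 2 * ∑ i, (2 * a i) ^ (k + 1) := by
  obtain ⟨U, l, hU1, hU2, h⟩ := exists_orthogonal_diag hM
  have hrow : ∀ i, ∑ j, U i j ^ 2 = 1 := by
    intro i
    have := congrFun (congrFun hU1 i) i
    rw [Matrix.mul_apply, Matrix.one_apply_eq] at this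
    simpa [Matrix.transpose_apply, sq] using this
  have scalar : ∀ x b : ℝ, 0 ≤ x → 0 ≤ b →
      x * b ^ k ≤ 1 / 2 * b ^ (k + 1) + 1 / 2 * (2 * x) ^ (k + 1) := by
    intro x b hx hb
    have hp1 : 0 ≤ b ^ (k + 1) := by positivity
    have hp2 : 0 ≤ (2 * x) ^ (k + 1) := by positivity
    rcases le_total (2 * x) b with hxb | hxb
    · have : 2 * x * b ^ k ≤ b * b ^ k := by gcongr
      rw [pow_succ']
      rw [pow_succ'] at hp1
      linarith
    · have : 2 * x * b ^ k ≤ 2 * x * (2 * x) ^ k := by gcongr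
      rw [pow_succ' (2 * x)]
      rw [pow_succ'] at hp2
      linarith
  rw [Matrix.trace, Finset.mul_sum, Finset.mul_sum, ← Finset.sum_add_distrib]
  refine Finset.sum_le_sum fun i _ => ?_
  rw [Matrix.diag_apply, pow_apply_self_eq h, pow_apply_self_eq h]
  calc a i * ∑ j, l j ^ (2 * k) * U i j ^ 2
      = ∑ j, (a i * (l j ^ 2) ^ k) * U i j ^ 2 := by
        rw [Finset.mul_sum]
        exact Finset.sum_congr rfl fun j _ => by rw [pow_mul]; ring
    _ ≤ ∑ j, (1 / 2 * (l j ^ 2) ^ (k + 1) + 1 / 2 * (2 * a i) ^ (k + 1)) * U i j ^ 2 :=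
        Finset.sum_le_sum fun j _ => mul_le_mul_of_nonneg_right
          (scalar _ _ (ha i) (sq_nonneg _)) (sq_nonneg _)
    _ = 1 / 2 * ∑ j, l j ^ (2 * (k + 1)) * U i j ^ 2
        + 1 / 2 * (2 * a i) ^ (k + 1) * ∑ j, U i j ^ 2 := by
        rw [Finset.mul_sum, Finset.mul_sum, ← Finset.sum_add_distrib]
        exact Finset.sum_congr rfl fun j _ => by rw [pow_mul]; ring
    _ = _ := by rw [hrow, mul_one]

/-- A matrix Rosenthal-type recursion for centred Bernoulli matrix series. -/
lemma bernExp_trace_pow_le {q : ℝ} (h0 : 0 ≤ q) (h1 : q ≤ 1) {H : ι → Matrix m m ℝ}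
    (hH : ∀ e, (H e).transpose = H e) (k : ℕ) :
    bernExp q (fun ω => (centredSum q H ω ^ (2 * (k + 1))).trace)
      ≤ (2 * k + 1) * bernExp q (fun ω => ∑ e,
        ((1 - q) * boolVal (ω e) + q * (1 - boolVal (ω e)))
          * (H e * H e * centredSum q H ω ^ (2 * k)).trace) := by
  have e1 : ∀ ω : ι → Bool, (centredSum q H ω ^ (2 * (k + 1))).trace
      = ∑ e, (boolVal (ω e) - q) * (H e * centredSum q H ω ^ (2 * k + 1)).trace := by
    intro ω
    rw [show 2 * (k + 1) = (2 * k + 1) + 1 by ring, pow_succ']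
    conv_lhs => enter [1, 1]; rw [centredSum]
    simp only [Finset.sum_mul, Matrix.trace_sum, Matrix.smul_mul, Matrix.trace_smul, smul_eq_mul]
  simp only [e1]
  rw [bernExp_sum, bernExp_sum, Finset.mul_sum]
  refine Finset.sum_le_sum fun e _ => ?_
  rw [bernExp_update q e, bernExp_update q e (fun ω => _ * _), ← bernExp_const_mul]
  refine bernExp_mono h0 h1 fun ω => ?_
  have := trace_mul_pow_sub_pow_le (centredSum_transpose q hH (Function.update ω e true))
    (centredSum_transpose q hH (Function.update ω e false)) (hH e)
    (centredSum_update_sub q H ω e) k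
  have h3 := mul_le_mul_of_nonneg_left this (mul_nonneg h0 (sub_nonneg.2 h1))
  simp only [Function.update_self, boolVal, if_true, Bool.false_eq_true, if_false]
  linarith

end MatrixMoments

section SpectralNorm

variable {n : ℕ}

lemma specNorm_le_of_sum_sq_le {M : Matrix (Fin n) (Fin n) ℝ} {R : ℝ} (hR : 0 ≤ R)
    (h : ∀ x : Fin n → ℝ, ∑ i, (M.mulVec x i) ^ 2 ≤ R ^ 2 * ∑ i, x i ^ 2) :
    specNorm M ≤ R := by
  refine ContinuousLinearMap.opNorm_le_bound _ hR fun x => ?_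
  refine le_of_sq_le_sq ?_ (by positivity)
  rw [mul_pow, EuclideanSpace.norm_sq_eq, EuclideanSpace.norm_sq_eq]
  simpa using h x.ofLp

lemma specNorm_add_le (M N : Matrix (Fin n) (Fin n) ℝ) :
    specNorm (M + N) ≤ specNorm M + specNorm N := by
  unfold specNorm
  rw [map_add, map_add]
  exact norm_add_le _ _

lemma specNorm_const_le (c : ℝ) :
    specNorm (Matrix.of fun _ _ : Fin n => c) ≤ |c| * n := by
  refine specNorm_le_of_sum_sq_le (by positivity) fun x => ?_
  have h : ∀ i : Fin n, (Matrix.of fun _ _ : Fin n => c).mulVec x i = c * ∑ j, x j := by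
    intro i
    simp [Matrix.mulVec, dotProduct, Finset.mul_sum]
  simp only [h]
  have h2 := sq_sum_le_card_mul_sum_sq (s := (Finset.univ : Finset (Fin n))) (f := x)
  simp only [Finset.sum_const, Finset.card_univ, Fintype.card_fin, nsmul_eq_mul] at h2 ⊢
  calc (n : ℝ) * (c * ∑ j, x j) ^ 2 = n * c ^ 2 * (∑ j, x j) ^ 2 := by ring
    _ ≤ n * c ^ 2 * (n * ∑ j, x j ^ 2) := by gcongr
    _ = _ := by rw [mul_pow, sq_abs]; ring

lemma specNorm_smul_one_le (c : ℝ) :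
    specNorm (c • (1 : Matrix (Fin n) (Fin n) ℝ)) ≤ |c| := by
  refine specNorm_le_of_sum_sq_le (abs_nonneg c) fun x => ?_
  simp [Matrix.smul_mulVec, mul_pow, Finset.mul_sum]

/-- A symmetric matrix is controlled in spectral norm by the trace of an even power. -/
lemma specNorm_le_of_trace_pow_le {M : Matrix (Fin n) (Fin n) ℝ} (hM : M.transpose = M)
    {R : ℝ} (hR : 0 ≤ R) (k : ℕ) (h : (M ^ (2 * (k + 1))).trace ≤ R ^ (2 * (k + 1))) :
    specNorm M ≤ R := by
  obtain ⟨U, l, hU1, hU2, hpow⟩ := exists_orthogonal_diag hM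
  rw [trace_pow_eq hU2 hpow] at h
  have hl : ∀ i, l i ^ 2 ≤ R ^ 2 := by
    intro i
    have h1 : l i ^ (2 * (k + 1)) ≤ ∑ i, l i ^ (2 * (k + 1)) :=
      Finset.single_le_sum (f := fun i => l i ^ (2 * (k + 1)))
        (fun j _ => by rw [pow_mul]; positivity) (Finset.mem_univ i)
    have h2 := h1.trans h
    rw [pow_mul, pow_mul] at h2
    exact le_of_pow_le_pow_left₀ (Nat.succ_ne_zero k) (sq_nonneg R) h2
  have iso : ∀ (V : Matrix (Fin n) (Fin n) ℝ), V.transpose * V = 1 → ∀ y : Fin n → ℝ,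
      ∑ i, (V.mulVec y i) ^ 2 = ∑ i, y i ^ 2 := by
    intro V hV y
    have : dotProduct (V.mulVec y) (V.mulVec y) = dotProduct y y := by
      rw [Matrix.dotProduct_mulVec, ← Matrix.mulVec_transpose, Matrix.mulVec_mulVec, hV,
        Matrix.one_mulVec]
    simpa [dotProduct, sq] using this
  refine specNorm_le_of_sum_sq_le hR fun x => ?_
  have h1 := hpow 1
  simp only [pow_one] at h1
  rw [h1, ← Matrix.mulVec_mulVec, ← Matrix.mulVec_mulVec, iso U hU2,
    ← iso U.transpose (by rwa [Matrix.transpose_transpose]) x, Finset.mul_sum]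
  refine Finset.sum_le_sum fun i _ => ?_
  rw [Matrix.mulVec_diagonal, mul_pow]
  exact mul_le_mul_of_nonneg_right (hl i) (sq_nonneg _)

/-- The spectral norm of a nonnegative symmetric matrix is controlled by the number of
weighted walks of length two from each node. -/
lemma specNorm_le_of_sum_mul_rowSum_le {M : Matrix (Fin n) (Fin n) ℝ}
    (hsymm : ∀ i j, M i j = M j i) (h0 : ∀ i j, 0 ≤ M i j) {R : ℝ} (hR : 0 ≤ R)
    (h : ∀ i, ∑ j, M i j * rowSum M j ≤ R ^ 2) : specNorm M ≤ R := by
  refine specNorm_le_of_sum_sq_le hR fun x => ?_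
  have e1 : ∀ i, (M.mulVec x i) ^ 2 ≤ rowSum M i * ∑ j, M i j * x j ^ 2 := by
    intro i
    have := Finset.sum_mul_sq_le_sq_mul_sq Finset.univ (fun j => √(M i j))
      (fun j => √(M i j) * x j)
    simp only [mul_pow, Real.sq_sqrt (h0 _ _), ← mul_assoc, Real.mul_self_sqrt (h0 _ _)] at this
    exact this
  calc ∑ i, (M.mulVec x i) ^ 2 ≤ ∑ i, rowSum M i * ∑ j, M i j * x j ^ 2 :=
        Finset.sum_le_sum fun i _ => e1 i
    _ = ∑ j, x j ^ 2 * ∑ i, M j i * rowSum M i := by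
        simp only [Finset.mul_sum]
        rw [Finset.sum_comm]
        refine Finset.sum_congr rfl fun j _ => Finset.sum_congr rfl fun i _ => ?_
        rw [hsymm i j]; ring
    _ ≤ ∑ j, x j ^ 2 * R ^ 2 :=
        Finset.sum_le_sum fun j _ => mul_le_mul_of_nonneg_left (h j) (sq_nonneg _)
    _ = _ := by rw [← Finset.sum_mul, mul_comm]

end SpectralNorm

section Graphs

variable {n : ℕ}

/-- The potential edges of a graph on `n` nodes. -/
abbrev Edge (n : ℕ) := {e : Fin n × Fin n // e.1 < e.2}

/-- The graph whose edge set is given by `ω`. -/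
def toGraph (ω : Edge n → Bool) (i j : Fin n) : Bool :=
  if h : i < j then ω ⟨(i, j), h⟩ else if h : j < i then ω ⟨(j, i), h⟩ else false

lemma toGraph_edge (ω : Edge n → Bool) (e : Edge n) : toGraph ω e.1.1 e.1.2 = ω e := by
  simp [toGraph, e.2]

lemma toGraph_comm (ω : Edge n → Bool) (i j : Fin n) : toGraph ω i j = toGraph ω j i := by
  rcases lt_trichotomy i j with h | h | h
  · simp [toGraph, h, h.not_gt]
  · rw [h]
  · simp [toGraph, h, h.not_gt]

lemma toGraph_self (ω : Edge n → Bool) (i : Fin n) : toGraph ω i i = false := by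
  simp [toGraph]

lemma isGraph_toGraph (ω : Edge n → Bool) : IsGraph (toGraph ω) :=
  ⟨toGraph_comm ω, toGraph_self ω⟩

lemma IsGraph.toGraph_eq {A : Fin n → Fin n → Bool} (hA : IsGraph A) :
    toGraph (fun e : Edge n => A e.1.1 e.1.2) = A := by
  funext i j
  rcases lt_trichotomy i j with h | h | h
  · simp [toGraph, h]
  · subst h; simp [toGraph, hA.2]
  · simp [toGraph, h, h.not_gt, hA.1 i j]

lemma adjMat_apply (A : Fin n → Fin n → Bool) (i j : Fin n) : adjMat A i j = boolVal (A i j) :=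
  rfl

lemma adjMat_toGraph_comm (ω : Edge n → Bool) (i j : Fin n) :
    adjMat (toGraph ω) i j = adjMat (toGraph ω) j i := by
  rw [adjMat_apply, adjMat_apply, toGraph_comm]

lemma erWeight_toGraph (q : ℝ) (ω : Edge n → Bool) :
    erWeight (Matrix.of fun i j => if i = j then 0 else q) (toGraph ω) = bernWeight q ω := by
  have h := Finset.prod_finset_product
    ((Finset.univ : Finset (Fin n × Fin n)).filter fun e => e.1 < e.2) Finset.univ
    (fun i => Finset.univ.filter fun j => i < j) (by simp)
    (f := fun e => if toGraph ω e.1 e.2 then q else 1 - q)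
  rw [Finset.prod_subtype _ (p := fun e : Fin n × Fin n => e.1 < e.2) (by simp)] at h
  simp only [toGraph_edge] at h
  rw [bernWeight, h, erWeight]
  refine Finset.prod_congr rfl fun i _ => Finset.prod_congr rfl fun j hj => ?_
  have : i ≠ j := (Finset.mem_filter.1 hj).2.ne
  simp [this]

lemma erProb_eq_bernProb (q : ℝ) (E : (Fin n → Fin n → Bool) → Prop) :
    erProb (Matrix.of fun i j => if i = j then 0 else q) E
      = bernProb q (fun ω : Edge n → Bool => IsGraph (toGraph ω) ∧ E (toGraph ω)) := by
  unfold erProb bernProb bernExp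
  simp only [mul_ite, mul_one, mul_zero]
  rw [← Finset.sum_filter]
  refine Finset.sum_nbij' (fun A e => A e.1.1 e.1.2) toGraph ?_ ?_ ?_ ?_ ?_
  · intro A hA
    have hA' := (Finset.mem_filter.1 hA).2
    simp only [Finset.mem_filter, Finset.mem_univ, true_and]
    rwa [hA'.1.toGraph_eq]
  · intro ω hω
    simpa using hω
  · intro A hA
    exact (Finset.mem_filter.1 hA).2.1.toGraph_eq
  · intro ω _
    funext e
    exact toGraph_edge ω e
  · intro A hA
    rw [← erWeight_toGraph, (Finset.mem_filter.1 hA).2.1.toGraph_eq]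

lemma sum_sum_eq_sum_edge {F : Fin n → Fin n → ℝ} (hF : ∀ i, F i i = 0) :
    ∑ i, ∑ j, F i j = ∑ e : Edge n, (F e.1.1 e.1.2 + F e.1.2 e.1.1) := by
  have h1 : ∀ G : Fin n → Fin n → ℝ,
      ∑ e : Edge n, G e.1.1 e.1.2 = ∑ i, ∑ j, if i < j then G i j else 0 := by
    intro G
    rw [← Fintype.sum_prod_type' (f := fun i j => if i < j then G i j else 0),
      ← Finset.sum_filter, Finset.sum_subtype _ (p := fun e : Fin n × Fin n => e.1 < e.2) (by simp)]
  rw [Finset.sum_add_distrib, h1 F, h1 (fun i j => F j i),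
    Finset.sum_comm (f := fun i j => if i < j then F j i else 0), ← Finset.sum_add_distrib]
  refine Finset.sum_congr rfl fun i _ => ?_
  rw [← Finset.sum_add_distrib]
  refine Finset.sum_congr rfl fun j _ => ?_
  rcases lt_trichotomy i j with h | h | h
  · simp [h, h.not_gt]
  · subst h; simp [hF]
  · simp [h, h.not_gt]

/-- The incidence of the node `i` with the potential edge `e`. -/
def incidence (i : Fin n) (e : Edge n) : ℝ :=
  (if e.1.1 = i then 1 else 0) + (if e.1.2 = i then 1 else 0)

lemma incidence_nonneg (i : Fin n) (e : Edge n) : 0 ≤ incidence i e := by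
  unfold incidence; positivity

lemma incidence_eq (i : Fin n) (e : Edge n) : incidence i e = 0 ∨ incidence i e = 1 := by
  have := e.2.ne
  unfold incidence
  by_cases h1 : e.1.1 = i
  · have h2 : e.1.2 ≠ i := fun h => this (h1.trans h.symm)
    simp [h1, h2]
  · by_cases h2 : e.1.2 = i <;> simp [h1, h2]

lemma incidence_le_one (i : Fin n) (e : Edge n) : incidence i e ≤ 1 := by
  rcases incidence_eq i e with h | h <;> simp [h]

lemma sum_incidence_mul (e : Edge n) (f : Fin n → ℝ) :
    ∑ i, incidence i e * f i = f e.1.1 + f e.1.2 := by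
  simp [incidence, add_mul, Finset.sum_add_distrib]

lemma sum_eq_sum_incidence {f : Fin n → Fin n → ℝ} (hf : ∀ i j, f i j = f j i)
    (i : Fin n) (h0 : f i i = 0) :
    ∑ j, f i j = ∑ e : Edge n, incidence i e * f e.1.1 e.1.2 := by
  have h := sum_sum_eq_sum_edge (F := fun k j => if k = i then f k j else 0)
    (fun k => by by_cases hk : k = i <;> simp [hk, h0])
  rw [Finset.sum_eq_single i (by intro b _ hb; simp [hb]) (by simp)] at h
  simp only [if_true] at h
  rw [h]
  refine Finset.sum_congr rfl fun e _ => ?_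
  rw [hf e.1.2 e.1.1, incidence, add_mul]
  simp

lemma rowSum_toGraph (ω : Edge n → Bool) (i : Fin n) :
    rowSum (adjMat (toGraph ω)) i = ∑ e, incidence i e * boolVal (ω e) := by
  rw [rowSum, sum_eq_sum_incidence (adjMat_toGraph_comm ω) i
    (by simp [adjMat_apply, toGraph_self, boolVal])]
  simp only [adjMat_apply, toGraph_edge]

lemma sum_incidence (i : Fin n) : ∑ e : Edge n, incidence i e = n - 1 := by
  have h := sum_eq_sum_incidence (f := fun i j : Fin n => if i = j then (0 : ℝ) else 1)
    (fun i j => by simp [eq_comm]) i (by simp)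
  have h2 : ∀ e : Edge n, (if e.1.1 = e.1.2 then (0 : ℝ) else 1) = 1 := fun e => by
    simp [e.2.ne]
  simp only [h2, mul_one] at h
  rw [← h]
  have h3 : ∀ j : Fin n, (if i = j then (0 : ℝ) else 1) = 1 - if i = j then 1 else 0 := by
    intro j
    split_ifs <;> norm_num
  simp [h3, Finset.sum_sub_distrib]

lemma sum_rowSum_toGraph (ω : Edge n → Bool) :
    ∑ i, rowSum (adjMat (toGraph ω)) i = 2 * ∑ e, boolVal (ω e) := by
  simp only [rowSum_toGraph]
  rw [Finset.sum_comm, Finset.mul_sum]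
  refine Finset.sum_congr rfl fun e _ => ?_
  rw [sum_incidence_mul e (fun _ => boolVal (ω e))]
  ring

lemma two_mul_card_edge : 2 * ∑ _e : Edge n, (1 : ℝ) = n * (n - 1) := by
  have h : ∑ i : Fin n, ∑ e : Edge n, incidence i e = n * (n - 1) := by
    simp [sum_incidence, mul_sub]
  rw [← h, Finset.sum_comm, Finset.mul_sum]
  refine Finset.sum_congr rfl fun e _ => ?_
  have := sum_incidence_mul e (fun _ => 1)
  simp only [mul_one] at this
  rw [this]
  norm_num

/-- The adjacency matrix of the single edge `e`. -/
def edgeMat (e : Edge n) : Matrix (Fin n) (Fin n) ℝ :=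
  Matrix.single e.1.1 e.1.2 1 + Matrix.single e.1.2 e.1.1 1

lemma edgeMat_transpose (e : Edge n) : (edgeMat e).transpose = edgeMat e := by
  rw [edgeMat, Matrix.transpose_add, Matrix.transpose_single, Matrix.transpose_single, add_comm]

lemma trace_edgeMat_sq_mul (e : Edge n) (B : Matrix (Fin n) (Fin n) ℝ) :
    (edgeMat e * edgeMat e * B).trace = ∑ i, incidence i e * B i i := by
  have h1 := e.2.ne
  have h2 : edgeMat e * edgeMat e
      = Matrix.single e.1.1 e.1.1 1 + Matrix.single e.1.2 e.1.2 1 := by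
    simp [edgeMat, add_mul, mul_add, Matrix.single_mul_single_of_ne, h1, h1.symm, add_comm]
  rw [h2, sum_incidence_mul, add_mul, Matrix.trace_add, Matrix.trace_single_mul,
    Matrix.trace_single_mul]
  simp

lemma sum_smul_edgeMat_apply {f : Fin n → Fin n → ℝ} (hf : ∀ i j, f i j = f j i)
    (hf0 : ∀ i, f i i = 0) :
    ∑ e : Edge n, f e.1.1 e.1.2 • edgeMat e = Matrix.of f := by
  ext i j
  have h := sum_sum_eq_sum_edge (F := fun k l => if k = i ∧ l = j then f k l else 0)
    (fun k => by simp [hf0])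
  rw [Finset.sum_eq_single i (by intro b _ hb; simp [hb]) (by simp),
    Finset.sum_eq_single j (by intro b _ hb; simp [hb]) (by simp)] at h
  simp only [and_self, if_true] at h
  rw [Matrix.of_apply, h, Matrix.sum_apply]
  refine Finset.sum_congr rfl fun e _ => ?_
  rw [hf e.1.2 e.1.1, Matrix.smul_apply, edgeMat, Matrix.add_apply, Matrix.single_apply,
    Matrix.single_apply, smul_eq_mul, mul_add]
  simp

/-- The centred adjacency matrix. -/
lemma centredSum_edgeMat (q : ℝ) (ω : Edge n → Bool) :
    centredSum q edgeMat ω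
      = Matrix.of fun i j => if i = j then 0 else adjMat (toGraph ω) i j - q := by
  rw [← sum_smul_edgeMat_apply (fun i j => ?_) (by simp), centredSum]
  · refine Finset.sum_congr rfl fun e _ => ?_
    rw [if_neg e.2.ne, adjMat_apply, toGraph_edge]
  · rw [adjMat_toGraph_comm ω i j]
    simp only [eq_comm]

end Graphs

section RandomGraphs

variable {n : ℕ}

lemma exp_sub_one_le_four_mul {x : ℝ} (h0 : 0 ≤ x) (h2 : x ≤ 2) : Real.exp x - 1 ≤ 4 * x := by
  have h := convexOn_exp.2 (Set.mem_univ (0 : ℝ)) (Set.mem_univ (2 : ℝ))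
    (by linarith : 0 ≤ 1 - x / 2) (by linarith : 0 ≤ x / 2) (by ring)
  have he : Real.exp 2 ≤ 9 := by
    have h1 : Real.exp 2 = Real.exp 1 ^ 2 := by rw [← Real.exp_nat_mul]; norm_num
    rw [h1]
    nlinarith [Real.exp_one_lt_three, Real.exp_pos 1]
  simp only [smul_eq_mul, mul_zero, zero_add, Real.exp_zero, mul_one] at h
  rw [show x / 2 * 2 = x by ring] at h
  nlinarith

lemma rowSum_nonneg (ω : Edge n → Bool) (i : Fin n) : 0 ≤ rowSum (adjMat (toGraph ω)) i :=
  Finset.sum_nonneg fun _ _ => boolVal_nonneg _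

lemma bernExp_exp_rowSum_le {q : ℝ} (h0 : 0 ≤ q) (h1 : q ≤ 1) {θ : ℝ} (hθ : 0 ≤ θ)
    (i : Fin n) :
    bernExp q (fun ω : Edge n → Bool => Real.exp (θ * rowSum (adjMat (toGraph ω)) i))
      ≤ Real.exp (q * n * (Real.exp θ - 1)) := by
  have h := bernExp_exp_le h0 h1 (fun e : Edge n => θ * incidence i e)
  have h2 : ∑ e : Edge n, (Real.exp (θ * incidence i e) - 1)
      = (Real.exp θ - 1) * ∑ e : Edge n, incidence i e := by
    rw [Finset.mul_sum]
    refine Finset.sum_congr rfl fun e _ => ?_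
    rcases incidence_eq i e with he | he <;> simp [he]
  simp only [rowSum_toGraph, Finset.mul_sum, ← mul_assoc]
  refine h.trans (Real.exp_le_exp.2 ?_)
  rw [h2, sum_incidence]
  have h3 : 0 ≤ Real.exp θ - 1 := by linarith [Real.one_le_exp hθ]
  nlinarith [mul_nonneg h0 h3]

lemma bernExp_trace_centred_pow_le {q : ℝ} (h0 : 0 ≤ q) (h1 : q ≤ 1) (k : ℕ) :
    bernExp q (fun ω : Edge n → Bool => (centredSum q edgeMat ω ^ (2 * (k + 1))).trace)
      ≤ bernExp q (fun ω => ∑ i : Fin n,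
        (2 * ((2 * k + 1) * (rowSum (adjMat (toGraph ω)) i + q * n))) ^ (k + 1)) := by
  have h := bernExp_trace_pow_le h0 h1 (edgeMat_transpose (n := n)) k
  rw [← bernExp_const_mul] at h
  have hpt : ∀ ω : Edge n → Bool,
      (2 * k + 1 : ℝ) * ∑ e, ((1 - q) * boolVal (ω e) + q * (1 - boolVal (ω e)))
          * (edgeMat e * edgeMat e * centredSum q edgeMat ω ^ (2 * k)).trace
      ≤ 1 / 2 * (centredSum q edgeMat ω ^ (2 * (k + 1))).trace
        + 1 / 2 * ∑ i : Fin n,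
          (2 * ((2 * k + 1) * (rowSum (adjMat (toGraph ω)) i + q * n))) ^ (k + 1) := by
    intro ω
    have hM := centredSum_transpose q (edgeMat_transpose (n := n)) ω
    refine le_trans ?_ (sum_mul_pow_apply_self_le hM (fun i => ?_) k)
    · simp only [trace_edgeMat_sq_mul, Finset.mul_sum]
      rw [Finset.sum_comm]
      refine Finset.sum_le_sum fun i _ => ?_
      have hB := pow_two_mul_apply_self_nonneg hM k i
      calc _ ≤ ∑ e : Edge n, ((2 * k + 1 : ℝ) * (incidence i e * boolVal (ω e)
              + q * incidence i e)) * (centredSum q edgeMat ω ^ (2 * k)) i i := by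
            refine Finset.sum_le_sum fun e _ => ?_
            rw [show ∀ a b c d : ℝ, a * (b * (c * d)) = a * (b * c) * d by intros; ring]
            refine mul_le_mul_of_nonneg_right ?_ hB
            refine mul_le_mul_of_nonneg_left ?_ (by positivity)
            have h3 := mul_nonneg h0 (boolVal_nonneg (ω e))
            have h4 := mul_nonneg h3 (incidence_nonneg i e)
            nlinarith
        _ ≤ _ := by
            rw [← Finset.sum_mul, ← Finset.mul_sum, Finset.sum_add_distrib, ← Finset.mul_sum,
              sum_incidence, ← rowSum_toGraph]
            gcongr
            linarith
    · have := rowSum_nonneg ω i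
      positivity
  have h2 := h.trans (bernExp_mono h0 h1 hpt)
  rw [bernExp_add, bernExp_const_mul, bernExp_const_mul] at h2
  linarith

lemma bernExp_pow_rowSum_le {q : ℝ} (h0 : 0 ≤ q) (h1 : q ≤ 1) (k : ℕ) (i : Fin n)
    (hpos : 0 < q * n) (hk : (k + 1 : ℝ) ≤ 2 * (q * n)) :
    bernExp q (fun ω : Edge n → Bool =>
        (2 * ((2 * k + 1) * (rowSum (adjMat (toGraph ω)) i + q * n))) ^ (k + 1))
      ≤ (4 * (k + 1) * (q * n)) ^ (k + 1) * Real.exp (4 * (k + 1)) := by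
  have hθ0 : 0 ≤ (k + 1 : ℝ) / (q * n) := by positivity
  have hθ2 : (k + 1 : ℝ) / (q * n) ≤ 2 := by rwa [div_le_iff₀ hpos]
  have hpt : ∀ ω : Edge n → Bool,
      (2 * ((2 * k + 1) * (rowSum (adjMat (toGraph ω)) i + q * n))) ^ (k + 1)
      ≤ (4 * (k + 1) * (q * n)) ^ (k + 1)
        * Real.exp ((k + 1 : ℝ) / (q * n) * rowSum (adjMat (toGraph ω)) i) := by
    intro ω
    have hr := rowSum_nonneg ω i
    set r := rowSum (adjMat (toGraph ω)) i
    have e1 : Real.exp ((k + 1 : ℝ) / (q * n) * r) = Real.exp (r / (q * n)) ^ (k + 1) := by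
      rw [← Real.exp_nat_mul]
      congr 1
      push_cast
      ring
    rw [e1, ← mul_pow]
    refine pow_le_pow_left₀ (by positivity) ?_ _
    have h3 := Real.add_one_le_exp (r / (q * n))
    have h4 : r + q * n = q * n * (r / (q * n) + 1) := by
      rw [mul_add, mul_div_cancel₀ _ hpos.ne', mul_one]
    rw [h4]
    calc 2 * ((2 * k + 1) * (q * n * (r / (q * n) + 1)))
        = (2 * (2 * k + 1) * (q * n)) * (r / (q * n) + 1) := by ring
      _ ≤ (4 * (k + 1) * (q * n)) * Real.exp (r / (q * n)) := by
          have : 2 * (2 * k + 1 : ℝ) ≤ 4 * (k + 1) := by linarith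
          gcongr
  refine (bernExp_mono h0 h1 hpt).trans ?_
  rw [bernExp_const_mul]
  refine mul_le_mul_of_nonneg_left ((bernExp_exp_rowSum_le h0 h1 hθ0 i).trans ?_) (by positivity)
  rw [Real.exp_le_exp]
  have h5 := mul_le_mul_of_nonneg_left (exp_sub_one_le_four_mul hθ0 hθ2) hpos.le
  refine h5.trans (le_of_eq ?_)
  rw [mul_left_comm, mul_div_cancel₀ _ hpos.ne']

/-- Spectral concentration of the adjacency matrix when the average degree is at least
logarithmic. -/
lemma bernProb_specNorm_centred_gt_le {q L : ℝ} (h0 : 0 ≤ q) (h1 : q ≤ 1) (hL1 : 1 ≤ L)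
    (hn : (n : ℝ) = Real.exp L) (hL : L ≤ q * n) :
    bernProb q (fun ω : Edge n → Bool =>
        √(52488 * (q * n * L)) < specNorm (centredSum q edgeMat ω))
      ≤ Real.exp (-2 * L) := by
  obtain ⟨k, hk⟩ : ∃ k, ⌈L⌉₊ = k + 1 :=
    Nat.exists_eq_succ_of_ne_zero (Nat.ceil_pos.2 (by linarith)).ne'
  have hk1 : L ≤ (k + 1 : ℝ) := by
    have := Nat.le_ceil L
    rw [hk] at this
    exact_mod_cast this
  have hk2 : (k + 1 : ℝ) ≤ 2 * L := by
    have := Nat.ceil_lt_add_one (by linarith : 0 ≤ L)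
    rw [hk] at this
    push_cast at this
    linarith
  have hd : 0 < q * n := by linarith
  set R2 : ℝ := 52488 * (q * n * L) with hR2
  have hR2pos : 0 < R2 := by positivity
  have hmk : bernProb q (fun ω : Edge n → Bool => √R2 < specNorm (centredSum q edgeMat ω))
      ≤ bernExp q (fun ω : Edge n → Bool =>
        (R2 ^ (k + 1))⁻¹ * (centredSum q edgeMat ω ^ (2 * (k + 1))).trace) := by
    have htr : ∀ ω : Edge n → Bool, 0 ≤ (centredSum q edgeMat ω ^ (2 * (k + 1))).trace :=
      fun ω => Finset.sum_nonneg fun i _ => pow_two_mul_apply_self_nonneg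
        (centredSum_transpose q edgeMat_transpose ω) _ i
    refine bernProb_le h0 h1 (fun ω => mul_nonneg (by positivity) (htr ω)) fun ω hω => ?_
    have h3 : R2 ^ (k + 1) < (centredSum q edgeMat ω ^ (2 * (k + 1))).trace := by
      by_contra hcon
      refine absurd hω (not_lt.2 (specNorm_le_of_trace_pow_le
        (centredSum_transpose q edgeMat_transpose ω) (Real.sqrt_nonneg _) k ?_))
      rw [pow_mul (√R2), Real.sq_sqrt hR2pos.le]
      exact not_lt.1 hcon
    rw [inv_mul_eq_div, one_le_div (by positivity)]
    exact h3.le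
  refine hmk.trans ?_
  rw [bernExp_const_mul, inv_mul_le_iff₀ (by positivity)]
  refine (bernExp_trace_centred_pow_le h0 h1 k).trans ?_
  rw [bernExp_sum]
  refine (Finset.sum_le_sum fun i _ =>
    bernExp_pow_rowSum_le h0 h1 k i hd (by linarith)).trans ?_
  rw [Finset.sum_const, Finset.card_univ, Fintype.card_fin, nsmul_eq_mul]
  have he8 : Real.exp 8 ≤ 6561 := by
    have h4 : Real.exp 8 = Real.exp 1 ^ 8 := by rw [← Real.exp_nat_mul]; norm_num
    rw [h4]
    calc Real.exp 1 ^ 8 ≤ 3 ^ 8 := by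
          gcongr
          exact Real.exp_one_lt_three.le
      _ = 6561 := by norm_num
  have h5 : 4 * (k + 1 : ℝ) * (q * n) ≤ R2 * Real.exp (-8) := by
    rw [Real.exp_neg, ← div_eq_mul_inv, le_div_iff₀ (Real.exp_pos 8)]
    calc 4 * (k + 1 : ℝ) * (q * n) * Real.exp 8 ≤ 4 * (2 * L) * (q * n) * 6561 := by gcongr
      _ = R2 := by rw [hR2]; ring
  calc (n : ℝ) * ((4 * (k + 1) * (q * n)) ^ (k + 1) * Real.exp (4 * (k + 1)))
      ≤ n * ((R2 * Real.exp (-8)) ^ (k + 1) * Real.exp (4 * (k + 1))) := by gcongr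
    _ = R2 ^ (k + 1) * (Real.exp L * Real.exp (-(4 * (k + 1)))) := by
        have h6 : Real.exp (-(4 * (k + 1)))
            = Real.exp (-8) ^ (k + 1) * Real.exp (4 * (k + 1)) := by
          rw [← Real.exp_nat_mul, ← Real.exp_add]
          congr 1
          push_cast
          ring
        rw [h6, mul_pow, hn]
        ring
    _ ≤ R2 ^ (k + 1) * Real.exp (-2 * L) := by
        rw [← Real.exp_add]
        gcongr
        linarith

/-- The number of walks of length two from a node, in terms of the edges of the graph. -/
lemma sum_adjMat_mul_rowSum (ω : Edge n → Bool) (i : Fin n) :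
    ∑ j, adjMat (toGraph ω) i j * rowSum (adjMat (toGraph ω)) j
      = ∑ e, (adjMat (toGraph ω) i e.1.1 + adjMat (toGraph ω) i e.1.2) * boolVal (ω e) := by
  simp only [rowSum_toGraph, Finset.mul_sum]
  rw [Finset.sum_comm]
  refine Finset.sum_congr rfl fun e _ => ?_
  rw [← sum_incidence_mul e (fun j => adjMat (toGraph ω) i j), Finset.sum_mul]
  exact Finset.sum_congr rfl fun j _ => by ring

lemma incidence_mul_adjMat (ω : Edge n → Bool) (i : Fin n) (e : Edge n) :
    incidence i e * (adjMat (toGraph ω) i e.1.1 + adjMat (toGraph ω) i e.1.2)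
      = incidence i e * boolVal (ω e) := by
  obtain ⟨⟨a, b⟩, hab⟩ := e
  have hab' : a < b := hab
  by_cases h1 : a = i
  · subst h1
    simp [incidence, hab'.ne', adjMat_apply, toGraph, hab', boolVal]
  · by_cases h2 : b = i
    · subst h2
      simp [incidence, h1, adjMat_apply, toGraph, hab', hab'.not_gt, boolVal]
    · simp [incidence, h1, h2]

/-- Exponential moment of the number of walks of length two from a node. -/
lemma bernExp_exp_walks_le {q : ℝ} (h0 : 0 ≤ q) (h1 : q ≤ 1) (i : Fin n)
    (hd : 1 ≤ q * n) :
    bernExp q (fun ω : Edge n → Bool => Real.exp ((q * n)⁻¹ *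
        ∑ j, adjMat (toGraph ω) i j * rowSum (adjMat (toGraph ω)) j))
      ≤ Real.exp (q * n * (Real.exp 9 - 1)) := by
  set θ : ℝ := (q * n)⁻¹ with hθ
  have hθ0 : 0 ≤ θ := by positivity
  have hθ1 : θ ≤ 1 := inv_le_one_of_one_le₀ hd
  set S : Finset (Edge n) := Finset.univ.filter fun e => incidence i e = 1
  rw [bernExp_piecewise q S]
  refine le_trans (bernExp_mono h0 h1 fun ω => ?_)
    (bernExp_exp_rowSum_le h0 h1 (by norm_num : (0 : ℝ) ≤ 9) i)
  set y : Edge n → ℝ := fun e => adjMat (toGraph ω) i e.1.1 + adjMat (toGraph ω) i e.1.2 with hy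
  have ha0 : ∀ j, 0 ≤ adjMat (toGraph ω) i j := fun j => boolVal_nonneg _
  have ha1 : ∀ j, adjMat (toGraph ω) i j ≤ 1 := fun j => boolVal_le_one _
  have hy0 : ∀ e, 0 ≤ y e := fun e => add_nonneg (ha0 _) (ha0 _)
  have hy2 : ∀ e, y e ≤ 2 := fun e => by linarith [ha1 e.1.1, ha1 e.1.2]
  set r := rowSum (adjMat (toGraph ω)) i with hr
  have hr0 : 0 ≤ r := rowSum_nonneg ω i
  have hsame : ∀ ω' : Edge n → Bool, ∀ j,
      adjMat (toGraph (S.piecewise ω ω')) i j = adjMat (toGraph ω) i j := by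
    intro ω' j
    simp only [adjMat_apply]
    congr 1
    rcases lt_trichotomy i j with h | h | h
    · have : (⟨(i, j), h⟩ : Edge n) ∈ S :=
        Finset.mem_filter.2 ⟨Finset.mem_univ _, by simp [incidence, h.ne']⟩
      simp [toGraph, h, this]
    · subst h; simp [toGraph_self]
    · have : (⟨(j, i), h⟩ : Edge n) ∈ S :=
        Finset.mem_filter.2 ⟨Finset.mem_univ _, by simp [incidence, h.ne]⟩
      simp [toGraph, h, h.not_gt, this]
  have hpt : ∀ ω' : Edge n → Bool,
      Real.exp (θ * ∑ j, adjMat (toGraph (S.piecewise ω ω')) i j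
        * rowSum (adjMat (toGraph (S.piecewise ω ω'))) j)
      ≤ Real.exp (θ * r) * Real.exp (∑ e, (θ * y e) * boolVal (ω' e)) := by
    intro ω'
    rw [← Real.exp_add, Real.exp_le_exp, sum_adjMat_mul_rowSum]
    simp only [mul_assoc, ← Finset.mul_sum]
    rw [← mul_add]
    refine mul_le_mul_of_nonneg_left ?_ hθ0
    rw [hr, rowSum_toGraph]
    simp only [← incidence_mul_adjMat]
    rw [← Finset.sum_add_distrib]
    refine Finset.sum_le_sum fun e _ => ?_
    rw [hsame, hsame]
    change y e * _ ≤ incidence i e * y e + y e * _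
    have hb0 := mul_nonneg (hy0 e) (boolVal_nonneg (ω' e))
    by_cases he : e ∈ S
    · have : incidence i e = 1 := (Finset.mem_filter.1 he).2
      rw [this]
      have := mul_le_mul_of_nonneg_left (boolVal_le_one (S.piecewise ω ω' e)) (hy0 e)
      linarith
    · rw [Finset.piecewise_eq_of_notMem _ _ _ he]
      have := mul_nonneg (incidence_nonneg i e) (hy0 e)
      linarith
  refine (bernExp_mono h0 h1 hpt).trans ?_
  rw [bernExp_const_mul]
  refine (mul_le_mul_of_nonneg_left (bernExp_exp_le h0 h1 _) (Real.exp_pos _).le).trans ?_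
  rw [← Real.exp_add, Real.exp_le_exp]
  have hsum : ∑ e, y e = r * (n - 1) := by
    have : ∀ e, y e = ∑ j, incidence j e * adjMat (toGraph ω) i j := fun e =>
      (sum_incidence_mul e _).symm
    simp only [this]
    rw [Finset.sum_comm]
    simp only [← Finset.sum_mul, sum_incidence]
    rw [← Finset.mul_sum, mul_comm, hr, rowSum]
  have h3 : ∑ e, (Real.exp (θ * y e) - 1) ≤ ∑ e, 4 * θ * y e := by
    refine Finset.sum_le_sum fun e _ => ?_
    have := exp_sub_one_le_four_mul (mul_nonneg hθ0 (hy0 e))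
      ((mul_le_mul hθ1 (hy2 e) (hy0 e) (by norm_num)).trans (by norm_num))
    linarith
  rw [← Finset.mul_sum, hsum] at h3
  have h4 := mul_le_mul_of_nonneg_left h3 h0
  have h5 : θ * (q * n) = 1 := inv_mul_cancel₀ (by linarith)
  have h6 : q * (4 * θ * (r * (n - 1))) = 4 * r * (θ * (q * n)) - 4 * r * θ * q := by ring
  rw [h6, h5] at h4
  have h7 : 0 ≤ r * θ * q := by positivity
  have h8 := mul_le_mul_of_nonneg_right hθ1 hr0
  linarith

end RandomGraphs

section Assembly

variable {n : ℕ}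

lemma bernProb_walks_gt_le {q L : ℝ} (h0 : 0 ≤ q) (h1 : q ≤ 1)
    (hn : (n : ℝ) = Real.exp L) (hd : 1 ≤ q * n) (hL : q * n ≤ L) :
    bernProb q (fun ω : Edge n → Bool => ∃ i, 19686 * (q * n * L) <
        ∑ j, adjMat (toGraph ω) i j * rowSum (adjMat (toGraph ω)) j)
      ≤ Real.exp (-2 * L) := by
  have hd0 : 0 < q * n := by linarith
  have he9 : Real.exp 9 ≤ 19683 := by
    have h4 : Real.exp 9 = Real.exp 1 ^ 9 := by rw [← Real.exp_nat_mul]; norm_num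
    rw [h4]
    calc Real.exp 1 ^ 9 ≤ 3 ^ 9 := by
          gcongr
          exact Real.exp_one_lt_three.le
      _ = 19683 := by norm_num
  have one : ∀ i : Fin n, bernProb q (fun ω : Edge n → Bool => 19686 * (q * n * L) <
        ∑ j, adjMat (toGraph ω) i j * rowSum (adjMat (toGraph ω)) j) ≤ Real.exp (-3 * L) := by
    intro i
    refine (bernProb_le h0 h1 (f := fun ω => Real.exp (-19686 * L) * Real.exp ((q * n)⁻¹ *
        ∑ j, adjMat (toGraph ω) i j * rowSum (adjMat (toGraph ω)) j))
        (fun ω => by positivity) fun ω hω => ?_).trans ?_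
    · rw [← Real.exp_add]
      refine Real.one_le_exp ?_
      have h3 := mul_le_mul_of_nonneg_left hω.le (inv_nonneg.2 hd0.le)
      have h4 : (q * n)⁻¹ * (19686 * (q * n * L)) = 19686 * L := by
        rw [mul_left_comm, ← mul_assoc (q * n)⁻¹, inv_mul_cancel₀ hd0.ne', one_mul]
      linarith
    · rw [bernExp_const_mul]
      refine (mul_le_mul_of_nonneg_left (bernExp_exp_walks_le h0 h1 i hd)
        (Real.exp_pos _).le).trans ?_
      rw [← Real.exp_add, Real.exp_le_exp]
      have : q * n * (Real.exp 9 - 1) ≤ L * 19682 :=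
        mul_le_mul hL (by linarith) (by linarith [Real.one_le_exp (by norm_num : (0 : ℝ) ≤ 9)])
          (by linarith)
      linarith
  refine (bernProb_exists_le h0 h1 _).trans ((Finset.sum_le_sum fun i _ => one i).trans ?_)
  rw [Finset.sum_const, Finset.card_univ, Fintype.card_fin, nsmul_eq_mul, hn, ← Real.exp_add,
    Real.exp_le_exp]
  linarith

lemma bernProb_rowSum_dev_le {q L : ℝ} (h0 : 0 ≤ q) (h1 : q ≤ 1)
    (hn : (n : ℝ) = Real.exp L) (hd : 16 ≤ q * n) (hL : 40 ≤ L) :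
    bernProb q (fun ω : Edge n → Bool => ∃ i, 3 / 2 * L * √(q * n) <
        |rowSum (adjMat (toGraph ω)) i - q * (n - 1)|) ≤ Real.exp (-2 * L) := by
  have hd0 : 0 < q * n := by linarith
  have hs4 : 4 ≤ √(q * n) := Real.le_sqrt_of_sq_le (by linarith)
  have hs0 : 0 < √(q * n) := by linarith
  have one : ∀ i : Fin n, bernProb q (fun ω : Edge n → Bool => 3 / 2 * L * √(q * n) <
        |rowSum (adjMat (toGraph ω)) i - q * (n - 1)|) ≤ 2 * Real.exp (16 - 6 * L) := by
    intro i
    have h := bernProb_abs_gt_le h0 h1 (incidence i) (incidence_nonneg i) (incidence_le_one i)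
      (m := q * n) (θ := 4 / √(q * n)) (3 / 2 * L * √(q * n))
      (by rw [sum_incidence]; linarith) (by positivity) ((div_le_one hs0).2 hs4)
    simp only [← rowSum_toGraph, sum_incidence] at h
    refine h.trans (le_of_eq ?_)
    rw [div_pow, Real.sq_sqrt hd0.le, mul_div_cancel₀ _ hd0.ne']
    congr 2
    field_simp
    ring
  refine (bernProb_exists_le h0 h1 _).trans ((Finset.sum_le_sum fun i _ => one i).trans ?_)
  rw [Finset.sum_const, Finset.card_univ, Fintype.card_fin, nsmul_eq_mul, hn]
  have h2 : (2 : ℝ) ≤ Real.exp 1 := by linarith [Real.add_one_le_exp 1]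
  calc Real.exp L * (2 * Real.exp (16 - 6 * L))
      ≤ Real.exp L * (Real.exp 1 * Real.exp (16 - 6 * L)) := by gcongr
    _ = Real.exp (L + (1 + (16 - 6 * L))) := by rw [Real.exp_add, Real.exp_add]
    _ ≤ _ := Real.exp_le_exp.2 (by linarith)

lemma bernProb_card_edges_dev_le {q L : ℝ} (h0 : 0 ≤ q) (h1 : q ≤ 1) (hd : 1 ≤ q * n)
    (hL : 1 ≤ L) (hLn : L ≤ n) :
    bernProb q (fun ω : Edge n → Bool => 9 / 2 * √(q * n * n * L) <
        |∑ e, boolVal (ω e) - q * (n * (n - 1) / 2)|) ≤ Real.exp (-2 * L) := by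
  have hn0 : (0 : ℝ) < n := by linarith
  have hdn : 0 < q * n * n := by positivity
  have hLdn : L ≤ q * n * n := hLn.trans (by nlinarith)
  have hc : ∑ _e : Edge n, (1 : ℝ) = n * (n - 1) / 2 := by linarith [two_mul_card_edge (n := n)]
  have h := bernProb_abs_gt_le h0 h1 (fun _ : Edge n => (1 : ℝ)) (fun _ => zero_le_one)
    (fun _ => le_rfl) (m := q * n * n / 2) (θ := √(L / (q * n * n)))
    (9 / 2 * √(q * n * n * L)) (by rw [hc]; nlinarith [mul_nonneg h0 hn0.le])
    (Real.sqrt_nonneg _) (Real.sqrt_le_one.2 ((div_le_one hdn).2 hLdn))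
  simp only [one_mul, hc] at h
  refine h.trans ?_
  have e1 : √(L / (q * n * n)) * (9 / 2 * √(q * n * n * L)) = 9 / 2 * L := by
    rw [mul_left_comm, ← Real.sqrt_mul (by positivity),
      show L / (q * n * n) * (q * n * n * L) = L ^ 2 by
        rw [← mul_assoc, div_mul_cancel₀ _ hdn.ne', sq], Real.sqrt_sq (by linarith)]
  have e2 : q * n * n / 2 * √(L / (q * n * n)) ^ 2 = L / 2 := by
    rw [Real.sq_sqrt (by positivity), div_mul_eq_mul_div, mul_div_cancel₀ _ hdn.ne']
  rw [e1, e2]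
  have h2 : (2 : ℝ) ≤ Real.exp 1 := by linarith [Real.add_one_le_exp 1]
  calc 2 * Real.exp (L / 2 - 9 / 2 * L) ≤ Real.exp 1 * Real.exp (L / 2 - 9 / 2 * L) := by gcongr
    _ = Real.exp (1 + (L / 2 - 9 / 2 * L)) := by rw [Real.exp_add]
    _ ≤ _ := Real.exp_le_exp.2 (by linarith)

lemma dbar_toGraph (ω : Edge n → Bool) :
    dbar (adjMat (toGraph ω)) = 2 * (∑ e, boolVal (ω e)) / n := by
  rw [← sum_rowSum_toGraph]
  rfl

lemma abs_dbar_sub_le {q L : ℝ} (hn0 : (0 : ℝ) < n) (ω : Edge n → Bool)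
    (h : |∑ e, boolVal (ω e) - q * (n * (n - 1) / 2)| ≤ 9 / 2 * √(q * n * n * L)) :
    |dbar (adjMat (toGraph ω)) - q * (n - 1)| ≤ 9 * √(q * n * L / n) := by
  have e1 : dbar (adjMat (toGraph ω)) - q * (n - 1)
      = (2 / n) * (∑ e, boolVal (ω e) - q * (n * (n - 1) / 2)) := by
    rw [dbar_toGraph]
    field_simp
  have e2 : √(q * n * L / n) = √(q * n * n * L) / n := by
    rw [show q * n * L / n = q * n * n * L / (n ^ 2) by field_simp,
      Real.sqrt_div' _ (by positivity), Real.sqrt_sq hn0.le]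
  rw [e1, e2, abs_mul, abs_of_pos (by positivity : (0 : ℝ) < 2 / n)]
  refine (mul_le_mul_of_nonneg_left h (by positivity)).trans (le_of_eq ?_)
  ring

lemma le_sqrt_div_of_le_one {q L : ℝ} (h0 : 0 ≤ q) (h1 : q ≤ 1) (hn0 : (0 : ℝ) < n)
    (hL : 1 ≤ L) : q ≤ √(q * n * L / n) := by
  refine Real.le_sqrt_of_sq_le ?_
  rw [show q * n * L / n = q * L by field_simp]
  nlinarith [mul_le_mul_of_nonneg_left hL h0]

/-- The spectral deviation from the constant matrix in terms of the centred adjacency matrix. -/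
lemma specNorm_sub_dbar_le_of_centred {q : ℝ} (h0 : 0 ≤ q) (hn0 : (0 : ℝ) < n)
    (ω : Edge n → Bool) :
    specNorm (Matrix.of fun i j => adjMat (toGraph ω) i j - dbar (adjMat (toGraph ω)) / n)
      ≤ specNorm (centredSum q edgeMat ω) + q + |dbar (adjMat (toGraph ω)) - q * n| := by
  set D := dbar (adjMat (toGraph ω)) with hD
  have e : (Matrix.of fun i j => adjMat (toGraph ω) i j - D / n)
      = (centredSum q edgeMat ω + (-q) • (1 : Matrix (Fin n) (Fin n) ℝ))
        + Matrix.of (fun _ _ : Fin n => (q - D / n)) := by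
    ext i j
    rw [centredSum_edgeMat, Matrix.add_apply, Matrix.add_apply, Matrix.smul_apply]
    by_cases hij : i = j
    · subst hij
      simp [adjMat_apply, toGraph_self, boolVal]
      ring
    · simp [hij]
  rw [e]
  refine (specNorm_add_le _ _).trans (add_le_add ((specNorm_add_le _ _).trans
    (add_le_add_right ((specNorm_smul_one_le _).trans ?_) _)) ((specNorm_const_le _).trans ?_))
  · rw [abs_neg, abs_of_nonneg h0]
  · rw [abs_sub_comm D, ← abs_of_pos hn0, ← abs_mul, abs_of_pos hn0, sub_mul,
      div_mul_cancel₀ _ hn0.ne']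

lemma specNorm_sub_dbar_le {A : Matrix (Fin n) (Fin n) ℝ} (hn0 : (0 : ℝ) < n) :
    specNorm (Matrix.of fun i j => A i j - dbar A / n) ≤ specNorm A + |dbar A| := by
  have e : (Matrix.of fun i j => A i j - dbar A / n)
      = A + Matrix.of (fun _ _ : Fin n => -(dbar A / n)) := by
    ext i j
    simp [sub_eq_add_neg]
  rw [e]
  refine (specNorm_add_le _ _).trans (add_le_add_right ((specNorm_const_le _).trans ?_) _)
  rw [abs_neg, ← abs_of_pos hn0, ← abs_mul, abs_of_pos hn0, div_mul_cancel₀ _ hn0.ne']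

/-- Adjacency matrices at small node distance yield feasible solutions. -/
lemma exists_P1_of_nodeDist_le {A A₀ : Fin n → Fin n → Bool} (hA₀ : IsGraph A₀) {η : ℝ}
    (h : (nodeDist A A₀ : ℝ) ≤ η * n) : ∃ z : Fin n → ℝ, P1 (adjMat A) η (adjMat A₀) z := by
  have hne : {k | ∃ S : Finset (Fin n), S.card = k ∧
      ∀ i j, i ∉ S → j ∉ S → A i j = A₀ i j}.Nonempty :=
    ⟨_, Finset.univ, rfl, fun i _ hi => absurd (Finset.mem_univ i) hi⟩
  obtain ⟨S, hcard, hS⟩ := Nat.sInf_mem hne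
  refine ⟨fun i => if i ∈ S then 0 else 1, fun i => ?_, ?_, fun i j => ?_, fun i j => ?_,
    fun i j => ?_⟩
  · by_cases hi : i ∈ S <;> simp [hi]
  · have e1 : ∀ i, (if i ∈ S then (0 : ℝ) else 1) = 1 - if i ∈ S then 1 else 0 := by
      intro i
      split_ifs <;> norm_num
    have e2 : (S.card : ℝ) ≤ η * n := by
      rw [hcard]
      exact h
    simp only [e1, Finset.sum_sub_distrib]
    simp
    linarith
  · rw [adjMat_apply, adjMat_apply, hA₀.1]
  · exact ⟨boolVal_nonneg _, boolVal_le_one _⟩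
  · by_cases hi : i ∈ S
    · simp [hi]
    · by_cases hj : j ∈ S
      · simp [hj]
      · rw [adjMat_apply, adjMat_apply, hS i j hi hj]

/-- The spectral part of the concentration statement. -/
lemma bernProb_specNorm_gt_le {q L : ℝ} (h0 : 0 ≤ q) (h1 : q ≤ 1)
    (hn : (n : ℝ) = Real.exp L) (hd : 1 ≤ q * n) (hL : 1 ≤ L) :
    bernProb q (fun ω : Edge n → Bool =>
        |dbar (adjMat (toGraph ω)) - q * n| ≤ 10 * √(q * n * L) ∧ 2 * 200 * √(q * n * L) <
          specNorm (Matrix.of fun i j =>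
            adjMat (toGraph ω) i j - dbar (adjMat (toGraph ω)) / n))
      ≤ Real.exp (-2 * L) := by
  have hn0 : (0 : ℝ) < n := by rw [hn]; exact Real.exp_pos L
  have hdL : 1 ≤ q * n * L := by nlinarith
  have hs1 : 1 ≤ √(q * n * L) := Real.one_le_sqrt.2 hdL
  rcases le_total L (q * n) with h | h
  · refine (bernProb_mono h0 h1 fun ω hω => ?_).trans
      (bernProb_specNorm_centred_gt_le h0 h1 hL hn h)
    have h2 := specNorm_sub_dbar_le_of_centred h0 hn0 ω
    have h3 : √(52488 * (q * n * L)) ≤ 230 * √(q * n * L) := by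
      rw [Real.sqrt_mul (by norm_num)]
      gcongr
      exact Real.sqrt_le_iff.2 ⟨by norm_num, by norm_num⟩
    linarith [hω.1, hω.2]
  · refine (bernProb_mono h0 h1 fun ω hω => ?_).trans (bernProb_walks_gt_le h0 h1 hn hd h)
    by_contra hcon
    have hcon' : ∀ i, ∑ j, adjMat (toGraph ω) i j * rowSum (adjMat (toGraph ω)) j
        ≤ 19686 * (q * n * L) := by simpa using hcon
    have h4 := specNorm_le_of_sum_mul_rowSum_le (adjMat_toGraph_comm ω)
      (fun i j => boolVal_nonneg (toGraph ω i j)) (Real.sqrt_nonneg (19686 * (q * n * L)))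
      (fun i => by rw [Real.sq_sqrt (by linarith)]; exact hcon' i)
    have h3 : √(19686 * (q * n * L)) ≤ 141 * √(q * n * L) := by
      rw [Real.sqrt_mul (by norm_num)]
      gcongr
      exact Real.sqrt_le_iff.2 ⟨by norm_num, by norm_num⟩
    have h5 : q * n ≤ √(q * n * L) := Real.le_sqrt_of_sq_le (by nlinarith)
    have h6 := specNorm_sub_dbar_le (A := adjMat (toGraph ω)) hn0
    have h7 : |dbar (adjMat (toGraph ω))| ≤ |dbar (adjMat (toGraph ω)) - q * n| + q * n := by
      have := abs_add_le (dbar (adjMat (toGraph ω)) - q * n) (q * n)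
      rwa [sub_add_cancel, abs_of_nonneg (by linarith : 0 ≤ q * n)] at this
    linarith [hω.1, hω.2]

end Assembly

/-- feasibility for fine estimation of Erdős–Rényi random
graphs: degree and spectral regularity hold with high probability, and yield
feasible solutions under corruption. -/
theorem fine_feasibility_er :
    ∃ C₀ > (0 : ℝ), ∃ C₁ > (0 : ℝ), ∃ c' > (0 : ℝ), ∃ N : ℕ, ∀ n ≥ N,
      ∀ d₀ η : ℝ, C₁ ≤ d₀ → d₀ ≤ n → 0 ≤ η → η ≤ 1 →
        1 - (n : ℝ) ^ (-c' : ℝ) ≤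
          erProb (Matrix.of fun i j => if i = j then 0 else d₀ / n)
            (fun A₀ =>
              |dbar (adjMat A₀) - d₀| ≤ 10 * Real.sqrt (d₀ * Real.log n / n) ∧
              (∀ i, |rowSum (adjMat A₀) i - dbar (adjMat A₀)| ≤
                2 * Real.log n * Real.sqrt d₀) ∧
              specNorm (Matrix.of fun i j =>
                  adjMat A₀ i j - dbar (adjMat A₀) / n) ≤
                2 * C₀ * Real.sqrt (d₀ * Real.log n) ∧
              (∀ A : Fin n → Fin n → Bool, IsGraph A →
                (nodeDist A A₀ : ℝ) ≤ η * n →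
                ∀ dhat : ℝ, d₀ / 2 ≤ dhat →
                  ∃ zstar : Fin n → ℝ,
                    P1 (adjMat A) η (adjMat A₀) zstar ∧
                    (∀ i, |rowSum (adjMat A₀) i - dbar (adjMat A₀)| ≤
                      4 * Real.log n * Real.sqrt dhat) ∧
                    specNorm (Matrix.of fun i j =>
                        adjMat A₀ i j - dbar (adjMat A₀) / n) ≤
                      4 * C₀ * Real.sqrt (Real.log n) * Real.sqrt dhat)) := by
  refine ⟨200, by norm_num, 16, by norm_num, 1, by norm_num, ⌈Real.exp 40⌉₊, ?_⟩
  intro n hn d₀ η hd hdn _ _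
  have hexp : Real.exp 40 ≤ n := Nat.ceil_le.1 hn
  have hn0 : (0 : ℝ) < n := (Real.exp_pos 40).trans_le hexp
  set L := Real.log n with hLdef
  have hnL : (n : ℝ) = Real.exp L := (Real.exp_log hn0).symm
  have hL : 40 ≤ L := (Real.le_log_iff_exp_le hn0).2 hexp
  have hLn : L ≤ n := by linarith [Real.add_one_le_exp L]
  obtain ⟨q, hq⟩ : ∃ q : ℝ, q = d₀ / n := ⟨_, rfl⟩
  have h0 : 0 ≤ q := by rw [hq]; exact div_nonneg (by linarith) hn0.le
  have h1 : q ≤ 1 := by rw [hq]; exact (div_le_one hn0).2 hdn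
  have hqn : q * n = d₀ := by rw [hq]; exact div_mul_cancel₀ _ hn0.ne'
  have hd16 : 16 ≤ q * n := by rw [hqn]; exact hd
  rw [← hq, erProb_eq_bernProb, bernProb_not]
  have hsmall : Real.exp (-2 * L) + (Real.exp (-2 * L) + Real.exp (-2 * L))
      ≤ (n : ℝ) ^ (-1 : ℝ) := by
    rw [Real.rpow_neg_one, hnL, ← Real.exp_neg,
      show -2 * L = -L + -L by ring, Real.exp_add]
    have h3 : Real.exp (-L) ≤ 1 / 3 := by
      rw [Real.exp_neg, ← hnL, inv_eq_one_div]
      exact one_div_le_one_div_of_le (by norm_num) (by linarith)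
    nlinarith [Real.exp_pos (-L)]
  refine sub_le_sub_left (le_trans ?_ hsmall) 1
  refine le_trans ?_ (add_le_add
    (bernProb_card_edges_dev_le h0 h1 (by linarith : 1 ≤ q * n) (by linarith : 1 ≤ L) hLn)
    (add_le_add (bernProb_rowSum_dev_le h0 h1 hnL hd16 hL)
      (bernProb_specNorm_gt_le h0 h1 hnL (by linarith : 1 ≤ q * n) (by linarith : 1 ≤ L))))
  refine le_trans ?_ (add_le_add_right (bernProb_or_le h0 h1 _ _) _)
  refine le_trans ?_ (bernProb_or_le h0 h1 _ _)
  refine bernProb_mono h0 h1 fun ω => ?_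
  contrapose!
  rintro ⟨hedges, hrow, hspec⟩
  have hdb := abs_dbar_sub_le hn0 ω hedges
  have hqs := le_sqrt_div_of_le_one h0 h1 hn0 (by linarith : 1 ≤ L)
  rw [hqn] at hdb hqs hrow hspec
  have hs_le : √(d₀ * L / n) ≤ √d₀ := by
    refine Real.sqrt_le_sqrt ((div_le_iff₀ hn0).2 ?_)
    gcongr
  have hdev : |dbar (adjMat (toGraph ω)) - d₀| ≤ 10 * √(d₀ * L / n) := by
    have := abs_add_le (dbar (adjMat (toGraph ω)) - q * (n - 1)) (-q)
    rw [show dbar (adjMat (toGraph ω)) - q * (n - 1) + -q = dbar (adjMat (toGraph ω)) - d₀ by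
      rw [← hqn]; ring, abs_neg, abs_of_nonneg h0] at this
    linarith
  have hrow' : ∀ i, |rowSum (adjMat (toGraph ω)) i - dbar (adjMat (toGraph ω))|
      ≤ 2 * L * √d₀ := by
    intro i
    have h3 := abs_sub_le (rowSum (adjMat (toGraph ω)) i) (q * (n - 1))
      (dbar (adjMat (toGraph ω)))
    rw [abs_sub_comm (q * (n - 1))] at h3
    have h4 := hrow i
    have h5 := mul_le_mul_of_nonneg_right hL (Real.sqrt_nonneg d₀)
    linarith
  have hspec' : specNorm (Matrix.of fun i j =>
      adjMat (toGraph ω) i j - dbar (adjMat (toGraph ω)) / n) ≤ 2 * 200 * √(d₀ * L) := by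
    refine hspec (hdev.trans ?_)
    gcongr
    exact div_le_self (by positivity) (by linarith)
  refine ⟨isGraph_toGraph ω, hdev, hrow', hspec', fun A _ hA dhat hdhat => ?_⟩
  obtain ⟨z, hz⟩ := exists_P1_of_nodeDist_le (isGraph_toGraph ω) hA
  have hroot : √d₀ ≤ 2 * √dhat := by
    rw [Real.sqrt_le_left (by positivity), mul_pow, Real.sq_sqrt (by linarith)]
    linarith
  refine ⟨z, hz, fun i => (hrow' i).trans ?_, hspec'.trans ?_⟩
  · calc 2 * L * √d₀ ≤ 2 * L * (2 * √dhat) := by gcongr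
      _ = 4 * L * √dhat := by ring
  · rw [Real.sqrt_mul (by linarith)]
    calc 2 * 200 * (√d₀ * √L) ≤ 2 * 200 * ((2 * √dhat) * √L) := by gcongr
      _ = 4 * 200 * √L * √dhat := by ring

end EdgeDensity
end

section
/- There exist absolute constants C₀, C₁, c', c'', K > 0 such that the following holds for all sufficiently large n. Let d° satisfy C₁ ≤ d° ≤ n, let η ∈ [0, c''], and let d̂ satisfy d°/2 ≤ d̂ ≤ 3d°/2. Then with probability at least 1 − n^{−c'} over a random graph A° drawn from the Erdős–Rényi distribution G(n, d°/n), the following holds: for every n-node graph A with dist(A, A°) ≤ η·n and every pair (Y, z) satisfying the feasibility constraints P1(A, η) with |(Y·𝟙)_i − d(Y)| ≤ 4·(log n)·√d̂ for all i and ‖Y − (d(Y)/n)·𝟙𝟙ᵀ‖ ≤ 4·C₀·√(log n)·√d̂ (‖·‖ the spectral norm), one has |d(Y) − d°| ≤ K·( √(d°·log n/n) + η·(log n)·√d° ). -/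
open scoped BigOperators Classical

namespace EdgeDensity

/-- The index pairs `(i, j)` with `i < j`. -/
def upperPairs (n : ℕ) : Finset (Fin n × Fin n) :=
  Finset.univ.filter fun e => e.1 < e.2

/-- The index pairs `(i, j)` with `i < j` that meet `B`. -/
noncomputable def incidentPairs {n : ℕ} (B : Finset (Fin n)) : Finset (Fin n × Fin n) :=
  (upperPairs n).filter fun e => e.1 ∈ B ∨ e.2 ∈ B

/-- The number of edges of `A` inside `F`, centred by `p` per pair. -/
noncomputable def edgeDev {n : ℕ} (p : ℝ) (F : Finset (Fin n × Fin n))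
    (A : Fin n → Fin n → Bool) : ℝ :=
  ∑ e ∈ F, ((if A e.1 e.2 then (1 : ℝ) else 0) - p)

/-- The edge probability matrix of `G(n,p)`. -/
noncomputable def erMat (n : ℕ) (p : ℝ) : Matrix (Fin n) (Fin n) ℝ :=
  Matrix.of fun i j => if i = j then 0 else p

theorem card_upperPairs_le (n : ℕ) : ((upperPairs n).card : ℝ) ≤ (n : ℝ) * n := by
  have h : (upperPairs n).card ≤ n * n := by
    simpa using Finset.card_le_univ (upperPairs n)
  exact_mod_cast h

theorem card_incidentPairs_le {n : ℕ} (B : Finset (Fin n)) :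
    ((incidentPairs B).card : ℝ) ≤ 2 * B.card * n := by
  have hsub : incidentPairs B ⊆ B ×ˢ Finset.univ ∪ Finset.univ ×ˢ B := by
    intro e he
    simp only [incidentPairs, Finset.mem_filter] at he
    simpa using he.2
  have h : (incidentPairs B).card ≤ B.card * n + n * B.card := by
    refine (Finset.card_le_card hsub).trans ((Finset.card_union_le _ _).trans ?_)
    simp
  have h' : ((incidentPairs B).card : ℝ) ≤ B.card * n + n * B.card := by exact_mod_cast h
  linarith

theorem prod_upperPairs {n : ℕ} (f : Fin n → Fin n → ℝ) :
    ∏ i, ∏ j ∈ Finset.univ.filter (fun j => i < j), f i j =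
      ∏ e ∈ upperPairs n, f e.1 e.2 := by
  simp only [upperPairs, Finset.prod_filter]
  rw [Fintype.prod_prod_type]

theorem sum_isGraph_prod {n : ℕ} (g : Fin n × Fin n → Bool → ℝ) :
    ∑ A ∈ Finset.univ.filter (fun A : Fin n → Fin n → Bool => IsGraph A),
        ∏ e ∈ upperPairs n, g e (A e.1 e.2) =
      ∏ e ∈ upperPairs n, (g e true + g e false) := by
  rw [Finset.prod_add]
  refine Finset.sum_bij' (fun A _ => (upperPairs n).filter fun e => A e.1 e.2 = true)
    (fun t _ i j => decide ((i, j) ∈ t ∨ (j, i) ∈ t)) ?_ ?_ ?_ ?_ ?_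
  · intro A _
    simp
  · intro t ht
    rw [Finset.mem_powerset] at ht
    refine Finset.mem_filter.2 ⟨Finset.mem_univ _, fun i j => by simp [or_comm], fun i => ?_⟩
    have : (i, i) ∉ t := fun h => by simpa [upperPairs] using ht h
    simp [this]
  · intro A hA
    simp only [Finset.mem_filter, Finset.mem_univ, true_and] at hA
    funext i j
    rcases lt_trichotomy i j with h | h | h
    · simp [upperPairs, h, h.not_gt]
    · subst h
      simp [upperPairs, hA.2]
    · simp [upperPairs, h, h.not_gt, hA.1 i j]
  · intro t ht
    rw [Finset.mem_powerset] at ht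
    ext ⟨i, j⟩
    simp only [Finset.mem_filter, decide_eq_true_eq]
    constructor
    · rintro ⟨h1, h2 | h2⟩
      · exact h2
      · have h3 := ht h2
        simp only [upperPairs, Finset.mem_filter, Finset.mem_univ, true_and] at h1 h3
        exact absurd h1 h3.not_gt
    · exact fun h => ⟨ht h, Or.inl h⟩
  · intro A _
    rw [← Finset.prod_filter_mul_prod_filter_not (upperPairs n) (fun e => A e.1 e.2 = true),
      ← Finset.filter_not]
    congr 1
    · exact Finset.prod_congr rfl fun e he => by rw [(Finset.mem_filter.1 he).2]
    · exact Finset.prod_congr rfl fun e he => by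
        rw [Bool.eq_false_of_not_eq_true (Finset.mem_filter.1 he).2]

theorem erWeight_erMat {n : ℕ} (p : ℝ) (A : Fin n → Fin n → Bool) :
    erWeight (erMat n p) A = ∏ e ∈ upperPairs n, (if A e.1 e.2 then p else 1 - p) := by
  rw [erWeight, prod_upperPairs (fun i j => if A i j then erMat n p i j else 1 - erMat n p i j)]
  refine Finset.prod_congr rfl fun e he => ?_
  simp only [upperPairs, Finset.mem_filter, Finset.mem_univ, true_and] at he
  simp [erMat, he.ne]

theorem erWeight_nonneg {n : ℕ} {p : ℝ} (h0 : 0 ≤ p) (h1 : p ≤ 1) (A : Fin n → Fin n → Bool) :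
    0 ≤ erWeight (erMat n p) A := by
  rw [erWeight_erMat]
  refine Finset.prod_nonneg fun e _ => ?_
  split_ifs <;> linarith

theorem sum_erWeight {n : ℕ} (p : ℝ) :
    ∑ A ∈ Finset.univ.filter (fun A : Fin n → Fin n → Bool => IsGraph A),
      erWeight (erMat n p) A = 1 := by
  simp only [erWeight_erMat]
  rw [sum_isGraph_prod (fun _ b => if b then p else 1 - p)]
  simp

theorem bernoulli_mgf_le {p l : ℝ} (h0 : 0 ≤ p) (hl : |l| ≤ 1) :
    p * Real.exp (l * (1 - p)) + (1 - p) * Real.exp (l * (0 - p)) ≤ Real.exp (l ^ 2 * p) := by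
  have h := Real.abs_exp_sub_one_sub_id_le hl
  have h2 : Real.exp l ≤ 1 + l + l ^ 2 := by linarith [(abs_le.1 h).2]
  have e1 : Real.exp (l * (1 - p)) = Real.exp l * Real.exp (-(l * p)) := by
    rw [← Real.exp_add]; ring_nf
  have e2 : Real.exp (l * (0 - p)) = Real.exp (-(l * p)) := by ring_nf
  rw [e1, e2]
  calc _ = (1 + p * (Real.exp l - 1)) * Real.exp (-(l * p)) := by ring
    _ ≤ Real.exp (p * (l + l ^ 2)) * Real.exp (-(l * p)) := by
        gcongr
        have := Real.add_one_le_exp (p * (l + l ^ 2))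
        nlinarith
    _ = _ := by rw [← Real.exp_add]; ring_nf

theorem edgeDev_mgf_le {n : ℕ} {p l : ℝ} (h0 : 0 ≤ p) (h1 : p ≤ 1) (hl : |l| ≤ 1)
    {F : Finset (Fin n × Fin n)} (hF : F ⊆ upperPairs n) :
    ∑ A ∈ Finset.univ.filter (fun A : Fin n → Fin n → Bool => IsGraph A),
      erWeight (erMat n p) A * Real.exp (l * edgeDev p F A) ≤
        Real.exp (l ^ 2 * (F.card * p)) := by
  obtain ⟨g, hg⟩ : ∃ g : Fin n × Fin n → Bool → ℝ, ∀ e b, g e b =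
      (if b then p else 1 - p) *
        (if e ∈ F then Real.exp (l * ((if b then 1 else 0) - p)) else 1) :=
    ⟨_, fun _ _ => rfl⟩
  have key : ∀ A : Fin n → Fin n → Bool,
      erWeight (erMat n p) A * Real.exp (l * edgeDev p F A) =
        ∏ e ∈ upperPairs n, g e (A e.1 e.2) := by
    intro A
    simp only [hg]
    rw [erWeight_erMat, edgeDev, Finset.mul_sum, Real.exp_sum, Finset.prod_mul_distrib,
      Finset.prod_ite_mem, Finset.inter_eq_right.2 hF]
  rw [Finset.sum_congr rfl fun A _ => key A, sum_isGraph_prod]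
  calc _ ≤ ∏ e ∈ upperPairs n, (if e ∈ F then Real.exp (l ^ 2 * p) else 1) := by
        simp only [hg]
        refine Finset.prod_le_prod (fun e _ => ?_) fun e _ => ?_
        · have : 0 ≤ 1 - p := by linarith
          split_ifs <;> simp <;> positivity
        · by_cases he : e ∈ F
          · simpa [he] using bernoulli_mgf_le h0 hl
          · simp [he]
    _ = _ := by
        rw [Finset.prod_ite_mem, Finset.inter_eq_right.2 hF, Finset.prod_const,
          ← Real.exp_nat_mul]
        ring_nf

theorem erProb_abs_edgeDev_gt_le {n : ℕ} {p l t : ℝ} (h0 : 0 ≤ p) (h1 : p ≤ 1) (hl0 : 0 ≤ l)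
    (hl : l ≤ 1) {F : Finset (Fin n × Fin n)} (hF : F ⊆ upperPairs n) :
    erProb (erMat n p) (fun A => t < |edgeDev p F A|) ≤
      2 * Real.exp (l ^ 2 * (F.card * p) - l * t) := by
  have hw := fun A : Fin n → Fin n → Bool => erWeight_nonneg h0 h1 A
  have hp := edgeDev_mgf_le h0 h1 (l := l) (by rwa [abs_of_nonneg hl0]) hF
  have hm := edgeDev_mgf_le h0 h1 (l := -l) (by rwa [abs_neg, abs_of_nonneg hl0]) hF
  calc erProb (erMat n p) (fun A => t < |edgeDev p F A|)
      ≤ ∑ A ∈ Finset.univ.filter (fun A : Fin n → Fin n → Bool => IsGraph A),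
          erWeight (erMat n p) A * ((Real.exp (l * edgeDev p F A) +
            Real.exp (-l * edgeDev p F A)) * Real.exp (-(l * t))) := by
        rw [erProb, ← Finset.filter_filter, Finset.sum_filter]
        refine Finset.sum_le_sum fun A _ => ?_
        split_ifs with h
        · refine le_mul_of_one_le_right (hw A) ?_
          rw [add_mul, ← Real.exp_add, ← Real.exp_add]
          rcases le_total 0 (edgeDev p F A) with hs | hs
          · rw [abs_of_nonneg hs] at h
            have : 1 ≤ Real.exp (l * edgeDev p F A + -(l * t)) :=
              Real.one_le_exp (by nlinarith)
            linarith [Real.exp_pos (-l * edgeDev p F A + -(l * t))]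
          · rw [abs_of_nonpos hs] at h
            have : 1 ≤ Real.exp (-l * edgeDev p F A + -(l * t)) :=
              Real.one_le_exp (by nlinarith)
            linarith [Real.exp_pos (l * edgeDev p F A + -(l * t))]
        · have := hw A
          positivity
    _ = (∑ A ∈ Finset.univ.filter (fun A : Fin n → Fin n → Bool => IsGraph A),
          erWeight (erMat n p) A * Real.exp (l * edgeDev p F A) +
        ∑ A ∈ Finset.univ.filter (fun A : Fin n → Fin n → Bool => IsGraph A),
          erWeight (erMat n p) A * Real.exp (-l * edgeDev p F A)) * Real.exp (-(l * t)) := by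
        rw [← Finset.sum_add_distrib, Finset.sum_mul]
        exact Finset.sum_congr rfl fun A _ => by ring
    _ ≤ (Real.exp (l ^ 2 * (F.card * p)) + Real.exp ((-l) ^ 2 * (F.card * p))) *
          Real.exp (-(l * t)) := by gcongr
    _ = _ := by
        rw [neg_sq, ← two_mul, mul_assoc, ← Real.exp_add, ← sub_eq_add_neg]

theorem one_sub_le_erProb {n : ℕ} {p : ℝ} (h0 : 0 ≤ p) (h1 : p ≤ 1) {ι : Type*}
    (s : Finset ι) (bad : ι → (Fin n → Fin n → Bool) → Prop)
    {E : (Fin n → Fin n → Bool) → Prop}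
    (hE : ∀ A, IsGraph A → (∀ i ∈ s, ¬ bad i A) → E A) :
    1 - ∑ i ∈ s, erProb (erMat n p) (bad i) ≤ erProb (erMat n p) E := by
  rw [sub_le_iff_le_add, ← sum_erWeight (n := n) p]
  simp only [erProb, ← Finset.filter_filter]
  simp only [Finset.sum_filter (p := E), Finset.sum_filter (p := bad _)]
  rw [Finset.sum_comm, ← Finset.sum_add_distrib]
  refine Finset.sum_le_sum fun A hA => ?_
  have hw := erWeight_nonneg h0 h1 A
  have hnn : ∀ i ∈ s, 0 ≤ if bad i A then erWeight (erMat n p) A else 0 := fun i _ => by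
    split_ifs <;> simp [hw]
  by_cases h : E A
  · simpa [h] using Finset.sum_nonneg hnn
  · have : ∃ i ∈ s, bad i A := by
      by_contra! hc
      exact h (hE A (Finset.mem_filter.1 hA).2 hc)
    obtain ⟨i, hi, hb⟩ := this
    have := Finset.single_le_sum hnn hi
    simpa [h, hb] using this

theorem sum_sum_eq_two_mul_sum_upperPairs {n : ℕ} (f : Fin n → Fin n → ℝ)
    (hs : ∀ i j, f i j = f j i) (hd : ∀ i, f i i = 0) :
    ∑ i, ∑ j, f i j = 2 * ∑ e ∈ upperPairs n, f e.1 e.2 := by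
  have hU : ∑ e ∈ upperPairs n, f e.1 e.2 = ∑ i, ∑ j, if i < j then f i j else 0 := by
    rw [upperPairs, Finset.sum_filter, Fintype.sum_prod_type]
  have hL : ∑ i, ∑ j, (if i < j then f i j else 0) = ∑ i, ∑ j, if j < i then f i j else 0 := by
    rw [Finset.sum_comm]
    simp only [hs]
  rw [two_mul, hU]
  nth_rewrite 2 [hL]
  simp only [← Finset.sum_add_distrib]
  refine Finset.sum_congr rfl fun i _ => Finset.sum_congr rfl fun j _ => ?_
  rcases lt_trichotomy i j with h | h | h
  · simp [h, h.not_gt]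
  · subst h; simp [hd]
  · simp [h, h.not_gt]

theorem sum_compl_sum_compl_adjMat {n : ℕ} (p : ℝ) {A : Fin n → Fin n → Bool} (hA : IsGraph A)
    (B : Finset (Fin n)) :
    ∑ i ∈ Bᶜ, ∑ j ∈ Bᶜ, adjMat A i j =
      p * ((Bᶜ.card : ℝ) ^ 2 - Bᶜ.card) +
        2 * (edgeDev p (upperPairs n) A - edgeDev p (incidentPairs B) A) := by
  have h1 : ∑ i ∈ Bᶜ, ∑ j ∈ Bᶜ, (adjMat A i j - if i = j then 0 else p) =
      2 * (edgeDev p (upperPairs n) A - edgeDev p (incidentPairs B) A) := by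
    have := sum_sum_eq_two_mul_sum_upperPairs
      (fun i j => if i ∈ Bᶜ ∧ j ∈ Bᶜ then adjMat A i j - (if i = j then 0 else p) else 0)
      (fun i j => by simp only [and_comm, adjMat, Matrix.of_apply, hA.1 i j, eq_comm])
      (fun i => by simp [adjMat, hA.2])
    have hl : ∑ i ∈ Bᶜ, ∑ j ∈ Bᶜ, (adjMat A i j - if i = j then 0 else p) =
        ∑ i, ∑ j, if i ∈ Bᶜ ∧ j ∈ Bᶜ then adjMat A i j - (if i = j then 0 else p) else 0 := by
      simp only [ite_and, Finset.sum_ite_mem, Finset.univ_inter, Finset.sum_ite_irrel,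
        Finset.sum_const_zero]
    rw [hl, this]
    congr 1
    rw [edgeDev, edgeDev, incidentPairs, eq_sub_iff_add_eq, Finset.sum_filter,
      ← Finset.sum_add_distrib]
    refine Finset.sum_congr rfl fun e he => ?_
    simp only [upperPairs, Finset.mem_filter, Finset.mem_univ, true_and] at he
    by_cases h1 : e.1 ∈ B <;> by_cases h2 : e.2 ∈ B <;> simp [h1, h2, he.ne, adjMat]
  have h2 : ∑ i ∈ Bᶜ, ∑ j ∈ Bᶜ, (if i = j then 0 else p) =
      p * ((Bᶜ.card : ℝ) ^ 2 - Bᶜ.card) := by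
    have : ∀ i ∈ Bᶜ, ∑ j ∈ Bᶜ, (if i = j then 0 else p) = Bᶜ.card * p - p := by
      intro i hi
      have h3 : ∀ j, (if i = j then 0 else p) = p - if i = j then p else 0 := fun j => by
        split_ifs <;> simp
      simp only [h3, Finset.sum_sub_distrib, Finset.sum_ite_eq, hi, if_true, Finset.sum_const,
        nsmul_eq_mul]
    rw [Finset.sum_congr rfl this, Finset.sum_const, nsmul_eq_mul]
    ring
  simp only [Finset.sum_sub_distrib] at h1
  linarith

theorem abs_sum_sum_le_specNorm {n : ℕ} (M : Matrix (Fin n) (Fin n) ℝ) (B : Finset (Fin n)) :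
    |∑ i ∈ B, ∑ j ∈ B, M i j| ≤ specNorm M * B.card := by
  set v : EuclideanSpace ℝ (Fin n) := WithLp.toLp 2 fun i => if i ∈ B then 1 else 0 with hv
  set T := LinearMap.toContinuousLinearMap (Matrix.toEuclideanLin M) with hT
  have hin : inner ℝ v (T v) = ∑ i ∈ B, ∑ j ∈ B, M i j := by
    simp [hT, hv, PiLp.inner_apply, Matrix.toEuclideanLin, Matrix.mulVec, dotProduct]
  have hn : ‖v‖ * ‖v‖ = B.card := by
    rw [← sq, EuclideanSpace.norm_sq_eq]
    simp [hv, apply_ite]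
  rw [← hin]
  calc |inner ℝ v (T v)| ≤ ‖v‖ * ‖T v‖ := abs_real_inner_le_norm _ _
    _ ≤ ‖v‖ * (‖T‖ * ‖v‖) := by gcongr; exact T.le_opNorm v
    _ = ‖T‖ * (‖v‖ * ‖v‖) := by ring
    _ = specNorm M * B.card := by rw [hn]; rfl

theorem abs_sum_compl_sum_compl_sub_le {n : ℕ} (hn : 0 < n) {Y : Matrix (Fin n) (Fin n) ℝ}
    (hY : ∀ i j, Y i j = Y j i) {D σ : ℝ} (hD : ∀ i, |rowSum Y i - dbar Y| ≤ D)
    (hσ : specNorm (Matrix.of fun i j => Y i j - dbar Y / n) ≤ σ) (B : Finset (Fin n)) :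
    |∑ i ∈ Bᶜ, ∑ j ∈ Bᶜ, Y i j - dbar Y / n * (Bᶜ.card : ℝ) ^ 2| ≤ B.card * (2 * D + σ) := by
  have hn' : (n : ℝ) ≠ 0 := by positivity
  have hc : (Bᶜ.card : ℝ) = n - B.card := by
    rw [Finset.card_compl, Fintype.card_fin, Nat.cast_sub (by simpa using Finset.card_le_univ B)]
  have h1 : |∑ i ∈ B, (rowSum Y i - dbar Y)| ≤ B.card * D := by
    refine (Finset.abs_sum_le_sum_abs _ _).trans ((Finset.sum_le_sum fun i _ => hD i).trans ?_)
    simp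
  have h2 := (abs_sum_sum_le_specNorm (Matrix.of fun i j => Y i j - dbar Y / n) B).trans
    (mul_le_mul_of_nonneg_right hσ (Nat.cast_nonneg _))
  have e2 : ∑ i ∈ B, ∑ j ∈ B, (Matrix.of fun i j => Y i j - dbar Y / n) i j =
      ∑ i ∈ B, ∑ j ∈ B, Y i j - dbar Y / n * (B.card : ℝ) ^ 2 := by
    simp only [Matrix.of_apply, Finset.sum_sub_distrib, Finset.sum_const, nsmul_eq_mul]
    ring
  have e1 : ∑ i ∈ B, (rowSum Y i - dbar Y) = ∑ i ∈ B, rowSum Y i - B.card * dbar Y := by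
    simp
  have hcs : ∀ f : Fin n → ℝ, ∑ i ∈ Bᶜ, f i = ∑ i, f i - ∑ i ∈ B, f i := fun f => by
    rw [← Finset.sum_add_sum_compl B f]; ring
  have htot : ∑ i, ∑ j, Y i j = n * dbar Y := by
    rw [dbar]; field_simp
  have hsym : ∑ i, ∑ j ∈ B, Y i j = ∑ i ∈ B, rowSum Y i :=
    Finset.sum_comm.trans
      (Finset.sum_congr rfl fun i _ => Finset.sum_congr rfl fun j _ => hY j i)
  have e3 : ∑ i ∈ Bᶜ, ∑ j ∈ Bᶜ, Y i j =
      n * dbar Y - 2 * ∑ i ∈ B, rowSum Y i + ∑ i ∈ B, ∑ j ∈ B, Y i j := by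
    simp only [hcs, Finset.sum_sub_distrib, htot, hsym]
    simp only [rowSum]
    ring
  rw [e2] at h2
  rw [e1] at h1
  have e4 : ∑ i ∈ Bᶜ, ∑ j ∈ Bᶜ, Y i j - dbar Y / n * (Bᶜ.card : ℝ) ^ 2 =
      (∑ i ∈ B, ∑ j ∈ B, Y i j - dbar Y / n * (B.card : ℝ) ^ 2) -
        2 * (∑ i ∈ B, rowSum Y i - B.card * dbar Y) := by
    rw [e3, hc]; field_simp; ring
  rw [e4, abs_le]
  rw [abs_le] at h1 h2
  constructor <;> linarith [h1.1, h1.2, h2.1, h2.2]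

/-- A feasible pair for a graph at small node distance from `A₀` agrees with `A₀` outside a
small set of nodes. -/
theorem exists_agree_compl {n : ℕ} {A A₀ : Fin n → Fin n → Bool} {η : ℝ}
    (hdist : (nodeDist A A₀ : ℝ) ≤ η * n) {Y : Matrix (Fin n) (Fin n) ℝ} {z : Fin n → ℝ}
    (hP : P1 (adjMat A) η Y z) :
    ∃ B : Finset (Fin n), (B.card : ℝ) ≤ 2 * η * n ∧
      ∀ i ∈ Bᶜ, ∀ j ∈ Bᶜ, Y i j = adjMat A₀ i j := by
  obtain ⟨hz, hzs, -, -, hYA⟩ := hP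
  obtain ⟨S, hS, hSA⟩ : nodeDist A A₀ ∈ {k | ∃ S : Finset (Fin n), S.card = k ∧
      ∀ i j, i ∉ S → j ∉ S → A i j = A₀ i j} :=
    Nat.sInf_mem ⟨_, Finset.univ, rfl, fun i j hi => absurd (Finset.mem_univ i) hi⟩
  have hZ : ((Finset.univ.filter fun i => z i = 0).card : ℝ) ≤ η * n := by
    have h1 : ∀ i, (if z i = 0 then (1 : ℝ) else 0) = 1 - z i := fun i => by
      rcases hz i with h | h <;> simp [h]
    rw [Finset.card_filter]
    push_cast
    simp only [h1, Finset.sum_sub_distrib]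
    simp only [Finset.sum_const, Finset.card_univ, Fintype.card_fin, nsmul_eq_mul, mul_one]
    linarith
  refine ⟨S ∪ Finset.univ.filter fun i => z i = 0, ?_, ?_⟩
  · have : ((S ∪ Finset.univ.filter fun i => z i = 0).card : ℝ) ≤
        S.card + (Finset.univ.filter fun i => z i = 0).card := by
      exact_mod_cast Finset.card_union_le _ _
    rw [hS] at this
    linarith
  · intro i hi j hj
    simp only [Finset.mem_compl, Finset.mem_union, Finset.mem_filter, Finset.mem_univ, true_and,
      not_or] at hi hj
    have h := hYA i j
    rw [(hz i).resolve_left hi.2, (hz j).resolve_left hj.2] at h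
    simpa [adjMat, hSA i j hi.1 hj.1] using h

theorem abs_dbar_sub_le_s17 {n : ℕ} (hn : 0 < n) (hL : 1 ≤ Real.log n) {d₀ η dhat : ℝ}
    (hd1 : 1 ≤ d₀) (hdn : d₀ ≤ n) (hη : η ≤ 1 / 8) (hdhat : dhat ≤ 3 * d₀ / 2)
    {A₀ : Fin n → Fin n → Bool} (hA₀ : IsGraph A₀)
    (htot : |edgeDev (d₀ / n) (upperPairs n) A₀| ≤ 5 * Real.sqrt (n * d₀ * Real.log n))
    (hinc : ∀ B : Finset (Fin n), B.Nonempty →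
      |edgeDev (d₀ / n) (incidentPairs B) A₀| ≤ 5 * (B.card * Real.log n * Real.sqrt d₀))
    {A : Fin n → Fin n → Bool} (hdist : (nodeDist A A₀ : ℝ) ≤ η * n)
    {Y : Matrix (Fin n) (Fin n) ℝ} {z : Fin n → ℝ} (hP : P1 (adjMat A) η Y z)
    (hrow : ∀ i, |rowSum Y i - dbar Y| ≤ 4 * Real.log n * Real.sqrt dhat)
    (hspec : specNorm (Matrix.of fun i j => Y i j - dbar Y / n) ≤
      4 * 1 * Real.sqrt (Real.log n) * Real.sqrt dhat) :
    |dbar Y - d₀| ≤ 300 * (Real.sqrt (d₀ * Real.log n / n) +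
      η * Real.log n * Real.sqrt d₀) := by
  obtain ⟨B, hB, hagree⟩ := exists_agree_compl hdist hP
  have hn' : (0 : ℝ) < n := by positivity
  have hincB : |edgeDev (d₀ / n) (incidentPairs B) A₀| ≤
      5 * (B.card * Real.log n * Real.sqrt d₀) := by
    rcases B.eq_empty_or_nonempty with rfl | h
    · simp [incidentPairs, edgeDev]
    · exact hinc B h
  have hY := abs_sum_compl_sum_compl_sub_le hn hP.2.2.1 hrow hspec B
  rw [Finset.sum_congr rfl fun i hi => Finset.sum_congr rfl fun j hj => hagree i hi j hj,
    sum_compl_sum_compl_adjMat (d₀ / n) hA₀ B] at hY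
  have hc : (Bᶜ.card : ℝ) = n - B.card := by
    rw [Finset.card_compl, Fintype.card_fin, Nat.cast_sub (by simpa using Finset.card_le_univ B)]
  set r : ℝ := (Bᶜ.card : ℝ)
  set b : ℝ := (B.card : ℝ)
  set L := Real.log n
  set s := Real.sqrt d₀ with hs
  set u := Real.sqrt (n * d₀ * L) with hu
  set d := dbar Y
  have hb0 : 0 ≤ b := Nat.cast_nonneg _
  have hs0 : 0 ≤ s := Real.sqrt_nonneg _
  have hsh : Real.sqrt dhat ≤ 2 * s := by
    rw [Real.sqrt_le_iff]
    refine ⟨by positivity, ?_⟩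
    rw [mul_pow, hs, Real.sq_sqrt (by linarith)]
    linarith
  have hsL : Real.sqrt L ≤ L := by
    rw [Real.sqrt_le_iff]
    exact ⟨by linarith, by nlinarith⟩
  have hr1 : n / 2 ≤ r := by nlinarith
  have hrn : r ≤ n := by linarith
  have hdu : d₀ ≤ u := by
    refine Real.le_sqrt_of_sq_le ?_
    have : d₀ * d₀ ≤ n * d₀ := by gcongr
    nlinarith [mul_pos hn' (by linarith : (0:ℝ) < d₀)]
  have hun : Real.sqrt (d₀ * L / n) = u / n := by
    have : d₀ * L / n = n * d₀ * L / n ^ 2 := by field_simp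
    rw [this, Real.sqrt_div' _ (by positivity), Real.sqrt_sq hn'.le]
  have hE : b * (2 * (4 * L * Real.sqrt dhat) + 4 * 1 * Real.sqrt L * Real.sqrt dhat) ≤
      24 * (b * L * s) := by
    calc _ ≤ b * (2 * (4 * L * (2 * s)) + 4 * 1 * L * (2 * s)) := by gcongr
      _ = _ := by ring
  have hbls : b * L * s ≤ 2 * η * n * L * s := by gcongr
  have hpr : d₀ / n * r ≤ d₀ := by
    rw [div_mul_eq_mul_div, div_le_iff₀ hn']
    gcongr
  have hpr0 : 0 ≤ d₀ / n * r := by positivity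
  have key : |(d - d₀) / n * r ^ 2| ≤ 11 * u + 68 * (η * n * L * s) := by
    have e : (d - d₀) / n * r ^ 2 = d / n * r ^ 2 - d₀ / n * r ^ 2 := by ring
    rw [e]
    rw [abs_le] at hY htot hincB ⊢
    constructor <;> linarith [hY.1, hY.2, htot.1, htot.2, hincB.1, hincB.2]
  have hr2 : n ^ 2 / 4 ≤ r ^ 2 := by nlinarith
  have h3 : |d - d₀| * (n / 4) ≤ 11 * u + 68 * (η * n * L * s) := by
    refine le_trans ?_ key
    rw [abs_mul, abs_div, abs_of_pos hn', abs_of_nonneg (sq_nonneg r)]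
    calc |d - d₀| * (n / 4) = |d - d₀| / n * (n ^ 2 / 4) := by field_simp
      _ ≤ _ := by gcongr
  rw [hun]
  have h4 : |d - d₀| * n ≤ (44 * (u / n) + 272 * (η * L * s)) * n := by
    have : (44 * (u / n) + 272 * (η * L * s)) * n = 44 * u + 272 * (η * n * L * s) := by
      field_simp
    rw [this]; linarith
  have h5 := le_of_mul_le_mul_right h4 hn'
  have h6 : 0 ≤ u / n := by positivity
  have h7 : 0 ≤ η * L * s := by
    have : 0 ≤ 2 * η * n := hb0.trans hB
    have : 0 ≤ η := by nlinarith
    positivity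
  linarith

theorem sum_nonempty_pow_card_le {n : ℕ} {x : ℝ} (hx : 0 ≤ x) (hnx : n * x ≤ 1) :
    ∑ B ∈ Finset.univ.filter (fun B : Finset (Fin n) => B.Nonempty), x ^ B.card ≤
      2 * (n * x) := by
  have h1 : ∑ B : Finset (Fin n), x ^ B.card = (x + 1) ^ n := by
    simpa using Fintype.sum_pow_mul_eq_add_pow (Fin n) x 1
  have h2 : Finset.univ.filter (fun B : Finset (Fin n) => B.Nonempty) =
      Finset.univ.erase ∅ := by
    ext B
    simp [Finset.nonempty_iff_ne_empty]
  have h3 := Finset.add_sum_erase Finset.univ (fun B : Finset (Fin n) => x ^ B.card)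
    (Finset.mem_univ ∅)
  have h4 : (x + 1) ^ n ≤ Real.exp (n * x) := by
    rw [Real.exp_nat_mul]
    exact pow_le_pow_left₀ (by positivity) (Real.add_one_le_exp x) n
  have h0 : 0 ≤ n * x := by positivity
  have h5 := Real.abs_exp_sub_one_le (x := n * x) (by rwa [abs_of_nonneg h0])
  rw [abs_of_nonneg h0] at h5
  rw [h2]
  simp only [Finset.card_empty, pow_zero] at h3
  linarith [(abs_le.1 h5).2]

theorem erProb_upperPairs_le {n : ℕ} (hn : 0 < n) (hL : 1 ≤ Real.log n) {d₀ : ℝ}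
    (hd1 : 1 ≤ d₀) (hdn : d₀ ≤ n) :
    erProb (erMat n (d₀ / n)) (fun A =>
      5 * Real.sqrt (n * d₀ * Real.log n) < |edgeDev (d₀ / n) (upperPairs n) A|) ≤
        2 * (1 / (n : ℝ)) ^ 3 := by
  have hn' : (0 : ℝ) < n := by positivity
  have hd0 : 0 < d₀ := by linarith
  set L := Real.log n with hLdef
  have hLn : L ≤ n := (Real.log_le_sub_one_of_pos hn').trans (by linarith)
  set l := Real.sqrt (L / (n * d₀)) with hl
  have hl1 : l ≤ 1 := by
    rw [hl, Real.sqrt_le_one, div_le_one (by positivity)]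
    nlinarith
  refine (erProb_abs_edgeDev_gt_le (by positivity) ((div_le_one hn').2 hdn)
    (Real.sqrt_nonneg _) hl1 (Finset.Subset.refl _)).trans ?_
  have h1 : l ^ 2 * ((upperPairs n).card * (d₀ / n)) ≤ L := by
    rw [hl, Real.sq_sqrt (by positivity)]
    calc _ ≤ L / (n * d₀) * ((n * n) * (d₀ / n)) := by
          gcongr; exact card_upperPairs_le n
      _ = L := by field_simp
  have h2 : l * (5 * Real.sqrt (n * d₀ * L)) = 5 * L := by
    have : l * Real.sqrt (n * d₀ * L) = L := by
      rw [hl, ← Real.sqrt_mul (by positivity)]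
      have : L / (n * d₀) * (n * d₀ * L) = L * L := by field_simp
      rw [this, Real.sqrt_mul_self (by linarith)]
    linarith
  have h3 : (1 / (n : ℝ)) ^ 3 = Real.exp (-(3 * L)) := by
    rw [Real.exp_neg, hLdef, show (3 : ℝ) = (3 : ℕ) by norm_num, Real.exp_nat_mul,
      Real.exp_log hn', one_div, inv_pow]
  rw [h3]
  gcongr
  linarith

theorem erProb_incidentPairs_le {n : ℕ} (hn : 0 < n) (hL : 1 ≤ Real.log n) {d₀ : ℝ}
    (hd1 : 1 ≤ d₀) (hdn : d₀ ≤ n) (B : Finset (Fin n)) :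
    erProb (erMat n (d₀ / n)) (fun A =>
      5 * (B.card * Real.log n * Real.sqrt d₀) < |edgeDev (d₀ / n) (incidentPairs B) A|) ≤
        2 * ((1 / (n : ℝ)) ^ 3) ^ B.card := by
  have hn' : (0 : ℝ) < n := by positivity
  have hd0 : 0 < d₀ := by linarith
  set L := Real.log n with hLdef
  have hs : 0 < Real.sqrt d₀ := Real.sqrt_pos.2 hd0
  have hl1 : 1 / Real.sqrt d₀ ≤ 1 := by
    rw [div_le_one hs]
    exact Real.one_le_sqrt.2 hd1
  refine (erProb_abs_edgeDev_gt_le (by positivity) ((div_le_one hn').2 hdn)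
    (by positivity) hl1 (F := incidentPairs B) (Finset.filter_subset _ _)).trans ?_
  have h1 : (1 / Real.sqrt d₀) ^ 2 * ((incidentPairs B).card * (d₀ / n)) ≤ 2 * B.card := by
    rw [div_pow, Real.sq_sqrt hd0.le]
    calc _ ≤ 1 ^ 2 / d₀ * ((2 * B.card * n) * (d₀ / n)) := by
          gcongr; exact card_incidentPairs_le B
      _ = _ := by field_simp
  have h2 : 1 / Real.sqrt d₀ * (5 * (B.card * L * Real.sqrt d₀)) = 5 * (B.card * L) := by
    field_simp
  have h3 : ((1 / (n : ℝ)) ^ 3) ^ B.card = Real.exp (-(3 * (B.card * L))) := by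
    rw [← pow_mul, one_div, inv_pow, Real.exp_neg,
      show 3 * (B.card * L) = ((3 * B.card : ℕ) : ℝ) * L by push_cast; ring, Real.exp_nat_mul,
      hLdef, Real.exp_log hn']
  rw [h3]
  have h4 : (B.card : ℝ) ≤ B.card * L := le_mul_of_one_le_right (by positivity) hL
  gcongr
  linarith

/-- fine identifiability for Erdős–Rényi random graphs, with
high probability. -/
theorem fine_identifiability_er_whp :
    ∃ C₀ > (0 : ℝ), ∃ C₁ > (0 : ℝ), ∃ c' > (0 : ℝ), ∃ c'' > (0 : ℝ),
      ∃ K > (0 : ℝ), ∃ N : ℕ, ∀ n ≥ N,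
      ∀ d₀ η dhat : ℝ, C₁ ≤ d₀ → d₀ ≤ n → 0 ≤ η → η ≤ c'' →
        d₀ / 2 ≤ dhat → dhat ≤ 3 * d₀ / 2 →
        1 - (n : ℝ) ^ (-c' : ℝ) ≤
          erProb (Matrix.of fun i j => if i = j then 0 else d₀ / n)
            (fun A₀ =>
              ∀ A : Fin n → Fin n → Bool, IsGraph A →
                (nodeDist A A₀ : ℝ) ≤ η * n →
                ∀ (Y : Matrix (Fin n) (Fin n) ℝ) (z : Fin n → ℝ),
                  P1 (adjMat A) η Y z →
                  (∀ i, |rowSum Y i - dbar Y| ≤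
                    4 * Real.log n * Real.sqrt dhat) →
                  specNorm (Matrix.of fun i j => Y i j - dbar Y / n) ≤
                    4 * C₀ * Real.sqrt (Real.log n) * Real.sqrt dhat →
                  |dbar Y - d₀| ≤
                    K * (Real.sqrt (d₀ * Real.log n / n) +
                          η * Real.log n * Real.sqrt d₀)) := by
  refine ⟨1, one_pos, 1, one_pos, 1, one_pos, 1 / 8, by norm_num, 300, by norm_num, 10, ?_⟩
  intro n hn d₀ η dhat hd1 hdn _ hη _ hdhat
  have hn10 : (10 : ℝ) ≤ n := by exact_mod_cast hn
  have hn0 : 0 < n := by omega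
  have hn' : (0 : ℝ) < n := by positivity
  have hL : 1 ≤ Real.log n := by
    rw [Real.le_log_iff_exp_le hn']
    linarith [Real.exp_one_lt_d9]
  set x : ℝ := (1 / (n : ℝ)) ^ 3 with hx
  let s : Finset (Option (Finset (Fin n))) :=
    Finset.insertNone (Finset.univ.filter fun B : Finset (Fin n) => B.Nonempty)
  let bad : Option (Finset (Fin n)) → (Fin n → Fin n → Bool) → Prop := fun o A =>
    o.elim (5 * Real.sqrt (n * d₀ * Real.log n) < |edgeDev (d₀ / n) (upperPairs n) A|)
      fun B => 5 * (B.card * Real.log n * Real.sqrt d₀) <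
        |edgeDev (d₀ / n) (incidentPairs B) A|
  refine le_trans ?_ (one_sub_le_erProb (p := d₀ / n) (by positivity) ((div_le_one hn').2 hdn)
    s bad ?_)
  · have hsum : ∑ o ∈ s, erProb (erMat n (d₀ / n)) (bad o) ≤ 2 * x + 2 * (2 * (n * x)) := by
      rw [Finset.sum_insertNone]
      refine add_le_add (erProb_upperPairs_le hn0 hL hd1 hdn) ?_
      refine (Finset.sum_le_sum fun B _ => erProb_incidentPairs_le hn0 hL hd1 hdn B).trans ?_
      rw [← Finset.mul_sum]
      gcongr
      refine sum_nonempty_pow_card_le (by positivity) ?_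
      rw [div_pow, one_pow, mul_one_div, div_le_one (by positivity)]
      nlinarith [sq_nonneg ((n : ℝ) - 1)]
    have hfin : 2 * x + 2 * (2 * (n * x)) ≤ (n : ℝ) ^ (-1 : ℝ) := by
      rw [Real.rpow_neg_one, hx]
      have : 2 * (1 / (n : ℝ)) ^ 3 + 2 * (2 * (n * (1 / (n : ℝ)) ^ 3)) =
          (2 + 4 * n) / n ^ 2 * (n : ℝ)⁻¹ := by field_simp; ring
      rw [this]
      refine mul_le_of_le_one_left (by positivity) ?_
      rw [div_le_one (by positivity)]
      nlinarith
    linarith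
  · intro A₀ hA₀ hbad A _ hdist Y z hP hrow hspec
    refine abs_dbar_sub_le_s17 hn0 hL hd1 hdn hη hdhat hA₀ ?_ (fun B hB => ?_) hdist hP hrow hspec
    · exact not_lt.1 (hbad none (by simp [s]))
    · exact not_lt.1 (hbad (some B) (by simp [s, hB]))

end EdgeDensity
end

section
/- Let n ∈ ℕ, α ≥ 0, d ∈ ℝ, and let R ⊆ ℝ^{n×n} be any set of matrices containing at least one symmetric matrix Y with 0 ≤ Y_ij ≤ 1 for all i,j and |d(Y) − d| ≤ α. For a symmetric matrix A ∈ {0,1}^{n×n} define score(d; A) := inf{ γ·n : γ ∈ [0,1] and there exists a pair (Y, z) satisfying the feasibility constraints P1(A, γ) with Y ∈ R and |d(Y) − d| ≤ α }. Then for any two symmetric matrices A, A' ∈ {0,1}^{n×n} that differ only in the entries of a single row and the corresponding column, |score(d; A) − score(d; A')| ≤ 1. -/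
open scoped BigOperators Classical

namespace EdgeDensity

/-- The score of a candidate average degree `d` with respect to a graph with
adjacency matrix `A`: the least `γ·n` over `γ ∈ [0,1]` such that some pair
`(Y, z)` satisfies the feasibility constraints `P1(A, γ)` with `Y` in the
regularity class `R` and `|d(Y) − d| ≤ α`. -/
noncomputable def score (n : ℕ) (R : Set (Matrix (Fin n) (Fin n) ℝ))
    (α d : ℝ) (A : Matrix (Fin n) (Fin n) ℝ) : ℝ :=
  sInf {s | ∃ γ : ℝ, 0 ≤ γ ∧ γ ≤ 1 ∧ s = γ * n ∧
    ∃ Y z, P1 A γ Y z ∧ Y ∈ R ∧ |dbar Y - d| ≤ α}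

theorem P1.update_zero {n : ℕ} {A A' Y : Matrix (Fin n) (Fin n) ℝ} {γ : ℝ} {z : Fin n → ℝ}
    {i₀ : Fin n} (hdiff : ∀ i j, i ≠ i₀ → j ≠ i₀ → A i j = A' i j) (h : P1 A γ Y z) :
    P1 A' (γ + 1 / n) Y (Function.update z i₀ 0) := by
  obtain ⟨hz, hsum, hsymm, hbd, hY⟩ := h
  have hn : (n : ℝ) ≠ 0 := by exact_mod_cast (Fin.pos i₀).ne'
  refine ⟨fun i => ?_, ?_, hsymm, hbd, fun i j => ?_⟩
  · by_cases hi : i = i₀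
    · simp [hi]
    · simpa [hi] using hz i
  · have hupdate : ∑ i, Function.update z i₀ 0 i = ∑ i, z i - z i₀ := by
      rw [Finset.sum_update_of_mem (Finset.mem_univ i₀), ← Finset.erase_eq,
        Finset.sum_erase_eq_sub (Finset.mem_univ i₀), zero_add]
    have hle : z i₀ ≤ 1 := by rcases hz i₀ with h | h <;> simp [h]
    have hγ : (1 - (γ + 1 / n)) * n = (1 - γ) * n - 1 := by field_simp; ring
    linarith
  · by_cases hi : i = i₀
    · simp [hi]
    by_cases hj : j = i₀
    · simp [hj]
    simpa [hi, hj, hdiff i j hi hj] using hY i j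

theorem P1.one_zero {n : ℕ} {Y : Matrix (Fin n) (Fin n) ℝ} (A : Matrix (Fin n) (Fin n) ℝ)
    (hsymm : ∀ i j, Y i j = Y j i) (hbd : ∀ i j, 0 ≤ Y i j ∧ Y i j ≤ 1) : P1 A 1 Y 0 :=
  ⟨by simp, by simp, hsymm, hbd, by simp⟩

theorem score_le {n : ℕ} {R : Set (Matrix (Fin n) (Fin n) ℝ)} {α d γ : ℝ}
    {A Y : Matrix (Fin n) (Fin n) ℝ} {z : Fin n → ℝ} (h0 : 0 ≤ γ) (h1 : γ ≤ 1)
    (hP : P1 A γ Y z) (hR : Y ∈ R) (hd : |dbar Y - d| ≤ α) : score n R α d A ≤ γ * n := by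
  refine csInf_le ⟨0, ?_⟩ ⟨γ, h0, h1, rfl, Y, z, hP, hR, hd⟩
  rintro _ ⟨γ', h0', -, rfl, -⟩
  positivity

theorem score_le_score_add_one {n : ℕ} {α d : ℝ} {R : Set (Matrix (Fin n) (Fin n) ℝ)}
    (hR : ∃ Y ∈ R, (∀ i j, Y i j = Y j i) ∧
      (∀ i j, 0 ≤ Y i j ∧ Y i j ≤ 1) ∧ |dbar Y - d| ≤ α)
    {A A' : Matrix (Fin n) (Fin n) ℝ} {i₀ : Fin n}
    (hdiff : ∀ i j, i ≠ i₀ → j ≠ i₀ → A i j = A' i j) :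
    score n R α d A' ≤ score n R α d A + 1 := by
  obtain ⟨Y₀, hY₀R, hY₀symm, hY₀bd, hY₀d⟩ := hR
  rw [← sub_le_iff_le_add]
  refine le_csInf ⟨_, 1, zero_le_one, le_rfl, rfl, Y₀, 0, P1.one_zero A hY₀symm hY₀bd,
    hY₀R, hY₀d⟩ ?_
  rintro _ ⟨γ, h0, -, rfl, Y, z, hP, hYR, hYd⟩
  rw [sub_le_iff_le_add]
  have hn : (0 : ℝ) < n := by exact_mod_cast Fin.pos i₀
  have hmul : (γ + 1 / n) * n = γ * n + 1 := by field_simp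
  rw [← hmul]
  rcases le_total (γ + 1 / n) 1 with h | h
  · exact score_le (by positivity) h (hP.update_zero hdiff) hYR hYd
  · exact (score_le zero_le_one le_rfl (P1.one_zero A' hY₀symm hY₀bd) hY₀R hY₀d).trans
      (by gcongr)

/-- the score function has node sensitivity at most `1`. -/
theorem score_sensitivity (n : ℕ) (α d : ℝ) (hα : 0 ≤ α)
    (R : Set (Matrix (Fin n) (Fin n) ℝ))
    (hR : ∃ Y ∈ R, (∀ i j, Y i j = Y j i) ∧
      (∀ i j, 0 ≤ Y i j ∧ Y i j ≤ 1) ∧ |dbar Y - d| ≤ α)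
    (A A' : Matrix (Fin n) (Fin n) ℝ)
    (hAsym : ∀ i j, A i j = A j i) (hA'sym : ∀ i j, A' i j = A' j i)
    (hA01 : ∀ i j, A i j = 0 ∨ A i j = 1)
    (hA'01 : ∀ i j, A' i j = 0 ∨ A' i j = 1)
    (hdiff : ∃ i₀, ∀ i j, i ≠ i₀ → j ≠ i₀ → A i j = A' i j) :
    |score n R α d A - score n R α d A'| ≤ 1 := by
  obtain ⟨i₀, h⟩ := hdiff
  have h₁ := score_le_score_add_one hR h
  have h₂ := score_le_score_add_one hR fun i j hi hj => (h i j hi hj).symm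
  rw [abs_le]
  constructor <;> linarith

end EdgeDensity
end
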